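/- arXiv:1011.5606 — 8 statements merged into one kernel-verified Lean document; each statement's English description precedes it below -/
import Mathlib

section
/- Suppose μ > 0 and λ + μ < 1. Then the Markov chain X admits a unique invariant probability measure π, and for every initial probability distribution ρ on S the n-step distributions converge to π in total variation: ‖∫ρ(dx) Pⁿ(x,·) − π(·)‖_TV → 0 as n → ∞. -/
open MeasureTheory ProbabilityTheory Filter

noncomputable section

/-- One step of the dynamics, given current state `x = (R, Z)` and noise `n`:
`R' = R − λ·max(−R,0) + λ(λ+μ)Z + max(min(ζ, r* − R), −ξ) + n`,
`Z' = max(−R,0) + (1−λ−μ)Z`. -/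
def step (lam mu zeta xi rstar : ℝ) (x : ℝ × ℝ) (n : ℝ) : ℝ × ℝ :=
  (x.1 - lam * max (-x.1) 0 + lam * (lam + mu) * x.2
      + max (min zeta (rstar - x.1)) (-xi) + n,
   max (-x.1) 0 + (1 - lam - mu) * x.2)

/-- The Gaussian noise distribution `N(0, σ²)`. -/
def noise (sigma : ℝ) : Measure ℝ := gaussianReal 0 (sigma ^ 2).toNNReal

/-- The one-step transition kernel `P(x, ·)`: the law of `step x N` with `N ~ N(0, σ²)`. -/
def kerP (lam mu zeta xi rstar sigma : ℝ) (x : ℝ × ℝ) : Measure (ℝ × ℝ) :=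
  (noise sigma).map (step lam mu zeta xi rstar x)

/-- The `n`-step transition kernel `Pⁿ(x, ·)`. -/
def kerPn (lam mu zeta xi rstar sigma : ℝ) : ℕ → (ℝ × ℝ) → Measure (ℝ × ℝ)
  | 0, x => Measure.dirac x
  | n + 1, x => (kerP lam mu zeta xi rstar sigma x).bind (kerPn lam mu zeta xi rstar sigma n)

/-- Total variation distance between two measures: sup over Borel sets of the
absolute difference. -/
def tvDist (m1 m2 : Measure (ℝ × ℝ)) : ℝ :=
  ⨆ B : { B : Set (ℝ × ℝ) // MeasurableSet B }, |(m1 B).toReal - (m2 B).toReal|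

end

section Harris

/-- If the oscillation of `φ` is controlled by `G x + G y`, then after centring, `φ` itself is
controlled by `G`. -/
lemma exists_center {α : Type*} [Nonempty α] {φ G : α → ℝ} (h : ∀ x y, |φ x - φ y| ≤ G x + G y) :
    ∃ c, ∀ x, |φ x - c| ≤ G x := by
  have key : ∀ x y, φ x - G x ≤ φ y + G y := fun x y => by
    linarith [(abs_le.1 (h x y)).2]
  obtain ⟨y₀⟩ := ‹Nonempty α›
  have hb : BddAbove (Set.range fun x => φ x - G x) :=
    ⟨φ y₀ + G y₀, by rintro _ ⟨x, rfl⟩; exact key x y₀⟩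
  have : Nonempty α := ⟨y₀⟩
  refine ⟨⨆ x, (φ x - G x), fun x => ?_⟩
  have h1 := le_ciSup hb x
  have h2 : ⨆ x, (φ x - G x) ≤ φ x + G x := ciSup_le fun z => key z x
  rw [abs_le]
  constructor <;> linarith

variable {α : Type*} [MeasurableSpace α]

/-- A `[0, 1]`-valued measurable function. -/
structure IsUnitTest (φ : α → ℝ) : Prop where
  measurable : Measurable φ
  nonneg : ∀ x, 0 ≤ φ x
  le_one : ∀ x, φ x ≤ 1

namespace IsUnitTest

variable {φ : α → ℝ}

lemma integrable (hφ : IsUnitTest φ) (ρ : Measure α) [IsFiniteMeasure ρ] : Integrable φ ρ :=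
  Integrable.of_bound hφ.measurable.aestronglyMeasurable 1
    (ae_of_all _ fun x => by
      rw [Real.norm_eq_abs, abs_of_nonneg (hφ.nonneg x)]; exact hφ.le_one x)

lemma abs_sub_le_one (hφ : IsUnitTest φ) (x y : α) : |φ x - φ y| ≤ 1 := by
  rw [abs_sub_le_iff]
  constructor <;> linarith [hφ.nonneg x, hφ.nonneg y, hφ.le_one x, hφ.le_one y]

lemma integral_kernel (hφ : IsUnitTest φ) (Q : Kernel α α) [IsMarkovKernel Q] :
    IsUnitTest (fun x => ∫ y, φ y ∂Q x) where
  measurable := (hφ.measurable.stronglyMeasurable.integral_kernel (κ := Q)).measurable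
  nonneg x := integral_nonneg hφ.nonneg
  le_one x := by
    calc ∫ y, φ y ∂Q x ≤ ∫ _, (1 : ℝ) ∂Q x :=
          integral_mono (hφ.integrable _) (integrable_const _) hφ.le_one
      _ = 1 := by simp

lemma indicator {B : Set α} (hB : MeasurableSet B) :
    IsUnitTest (B.indicator (fun _ => (1 : ℝ))) where
  measurable := measurable_const.indicator hB
  nonneg x := Set.indicator_nonneg (fun _ _ => zero_le_one) x
  le_one x := Set.indicator_le_self' (fun _ _ => zero_le_one) x

lemma integral_bind (hφ : IsUnitTest φ) (Q : Kernel α α) [IsMarkovKernel Q]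
    (ρ : Measure α) [IsProbabilityMeasure ρ] :
    ∫ x, φ x ∂(ρ.bind Q) = ∫ x, ∫ y, φ y ∂Q x ∂ρ := by
  rw [Measure.comp_eq_comp_const_apply, Kernel.integral_comp]
  · simp
  · exact hφ.integrable _

end IsUnitTest

/-- Two probability measures with a common minorant `ν`, tested against a function of controlled
weighted oscillation. -/
lemma integral_sub_integral_le {φ V : α → ℝ} (hφ : IsUnitTest φ) (hV0 : ∀ x, 0 ≤ V x)
    {β L : ℝ} (hβ : 0 ≤ β) (hL : 0 ≤ L)
    (h : ∀ x y, |φ x - φ y| ≤ L * (2 + β * (V x + V y)))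
    {p q ν : Measure α} [IsProbabilityMeasure p] [IsProbabilityMeasure q] [IsFiniteMeasure ν]
    (hp : ν ≤ p) (hq : ν ≤ q) (hVp : Integrable V p) (hVq : Integrable V q) :
    ∫ x, φ x ∂p - ∫ x, φ x ∂q
      ≤ L * (2 - 2 * ν.real Set.univ + β * (∫ x, V x ∂p + ∫ x, V x ∂q)) := by
  have : Nonempty α := nonempty_of_isProbabilityMeasure p
  obtain ⟨c, hc⟩ := exists_center (φ := φ) (G := fun x => L * (1 + β * V x))
    (fun x y => (h x y).trans_eq (by ring))
  set G : α → ℝ := fun x => L * (1 + β * V x) with hG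
  have hVν : Integrable V ν := hVp.mono_measure hp
  have intG : ∀ (m : Measure α) [IsFiniteMeasure m], Integrable V m → Integrable G m :=
    fun m _ hm => ((integrable_const _).add (hm.const_mul β)).const_mul L
  have intφ : ∀ (m : Measure α) [IsFiniteMeasure m], Integrable (fun x => φ x - c) m :=
    fun m _ => (hφ.integrable m).sub (integrable_const c)
  have eG : ∀ (m : Measure α) [IsFiniteMeasure m], Integrable V m →
      ∫ x, G x ∂m = L * (m.real Set.univ + β * ∫ x, V x ∂m) := by
    intro m _ hm
    rw [hG, integral_const_mul, integral_add (integrable_const _) (hm.const_mul β),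
      integral_const_mul]
    simp
  have eφ : ∀ (m : Measure α) [IsFiniteMeasure m],
      ∫ x, (φ x - c) ∂m = ∫ x, φ x ∂m - c * m.real Set.univ := by
    intro m _
    rw [integral_sub (hφ.integrable m) (integrable_const c)]
    simp [mul_comm]
  have m1 := integral_mono_measure hp
    (f := fun x => G x - (φ x - c))
    (ae_of_all _ fun x => by have := abs_le.1 (hc x); simp only [Pi.zero_apply]; linarith)
    ((intG p hVp).sub (intφ p))
  have m2 := integral_mono_measure hq
    (f := fun x => G x + (φ x - c))
    (ae_of_all _ fun x => by have := abs_le.1 (hc x); simp only [Pi.zero_apply]; linarith)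
    ((intG q hVq).add (intφ q))
  rw [integral_sub (intG ν hVν) (intφ ν), integral_sub (intG p hVp) (intφ p), eG ν hVν,
    eG p hVp, eφ, eφ] at m1
  rw [integral_add (intG ν hVν) (intφ ν), integral_add (intG q hVq) (intφ q), eG ν hVν,
    eG q hVq, eφ, eφ] at m2
  have hp1 : p.real Set.univ = 1 := by simp
  have hq1 : q.real Set.univ = 1 := by simp
  rw [hp1] at m1
  rw [hq1] at m2
  have h0 : 0 ≤ L * (β * ∫ x, V x ∂ν) :=
    mul_nonneg hL (mul_nonneg hβ (integral_nonneg hV0))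
  linarith

/-- The geometric contraction of weighted oscillations under a drift and a minorization
condition. -/
theorem exists_contraction (Q : Kernel α α) [IsMarkovKernel Q] {V : α → ℝ}
    (hV0 : ∀ x, 0 ≤ V x) {γ C : ℝ} (hγ0 : 0 ≤ γ) (hγ : γ < 1) (hC : 0 < C)
    (hVi : ∀ x, Integrable V (Q x)) (hdrift : ∀ x, ∫ y, V y ∂Q x ≤ γ * V x + C)
    (hminor : ∀ R : ℝ, ∃ ν : Measure α, IsFiniteMeasure ν ∧ ν ≠ 0 ∧ ∀ x, V x ≤ R → ν ≤ Q x) :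
    ∃ β a : ℝ, 0 < β ∧ 0 ≤ a ∧ a < 1 ∧ ∀ φ : α → ℝ, IsUnitTest φ → ∀ L : ℝ, 0 ≤ L →
      (∀ x y, |φ x - φ y| ≤ L * (2 + β * (V x + V y))) →
      ∀ x y, |∫ z, φ z ∂Q x - ∫ z, φ z ∂Q y| ≤ (a * L) * (2 + β * (V x + V y)) := by
  have hγ' : 0 < 1 - γ := by linarith
  set R : ℝ := 4 * C / (1 - γ) with hR
  have hR0 : 0 < R := by positivity
  have hRC : 2 * C = (1 - γ) / 2 * R := by rw [hR]; field_simp; ring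
  obtain ⟨ν, hνf, hν0, hν⟩ := hminor R
  set η := ν.real Set.univ with hη
  have hη0 : 0 < η := by
    rw [hη, measureReal_def]
    exact ENNReal.toReal_pos (by simpa using hν0) (measure_ne_top _ _)
  set β := η / (2 * C) with hβ
  have hβ0 : 0 < β := by positivity
  have hβC : β * (2 * C) = η := by rw [hβ]; field_simp
  have hβR : 0 < β * R := by positivity
  set b := (2 + (1 + γ) / 2 * (β * R)) / (2 + β * R) with hb
  have hb1 : b < 1 := by
    rw [hb, div_lt_one (by positivity)]
    nlinarith
  have hb2 : b * (2 + β * R) = 2 + (1 + γ) / 2 * (β * R) := by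
    rw [hb]; field_simp
  set a := max (max (1 - η / 2) ((1 + γ) / 2)) b with ha
  have ha1 : 1 - η / 2 ≤ a := (le_max_left _ _).trans (le_max_left _ _)
  have ha2 : (1 + γ) / 2 ≤ a := (le_max_right _ _).trans (le_max_left _ _)
  have ha3 : b ≤ a := le_max_right _ _
  refine ⟨β, a, hβ0, by linarith, ?_, ?_⟩
  · rw [ha]
    refine max_lt (max_lt (by linarith) (by linarith)) hb1
  intro φ hφ L hL h
  have one_sided : ∀ x y, ∫ z, φ z ∂Q x - ∫ z, φ z ∂Q y
      ≤ (a * L) * (2 + β * (V x + V y)) := by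
    intro x y
    have hs0 : 0 ≤ V x + V y := add_nonneg (hV0 x) (hV0 y)
    have hI : ∫ z, V z ∂Q x + ∫ z, V z ∂Q y ≤ γ * (V x + V y) + 2 * C := by
      linarith [hdrift x, hdrift y]
    have hβI := mul_le_mul_of_nonneg_left hI hβ0.le
    have hs1 : 0 ≤ β * (V x + V y) := by positivity
    rw [mul_comm a L, mul_assoc]
    by_cases hs : V x + V y ≤ R
    · refine (integral_sub_integral_le hφ hV0 hβ0.le hL h (hν x (by linarith [hV0 y]))
        (hν y (by linarith [hV0 x])) (hVi x) (hVi y)).trans ?_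
      refine mul_le_mul_of_nonneg_left ?_ hL
      have h1 : γ * (β * (V x + V y)) ≤ a * (β * (V x + V y)) :=
        mul_le_mul_of_nonneg_right (by linarith) hs1
      nlinarith
    · refine (integral_sub_integral_le (ν := 0) hφ hV0 hβ0.le hL h (Measure.zero_le _)
        (Measure.zero_le _) (hVi x) (hVi y)).trans ?_
      refine mul_le_mul_of_nonneg_left ?_ hL
      push Not at hs
      have h3 : β * R ≤ β * (V x + V y) := mul_le_mul_of_nonneg_left hs.le hβ0.le
      have h1 : b * (2 + β * R) ≤ a * (2 + β * R) :=
        mul_le_mul_of_nonneg_right ha3 (by positivity)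
      have h2 : (1 + γ) / 2 * (β * (V x + V y) - β * R) ≤ a * (β * (V x + V y) - β * R) :=
        mul_le_mul_of_nonneg_right ha2 (by linarith)
      have h4 : β * (2 * C) ≤ (1 - γ) / 2 * (β * (V x + V y)) := by
        rw [hRC]
        calc β * ((1 - γ) / 2 * R) = (1 - γ) / 2 * (β * R) := by ring
          _ ≤ _ := mul_le_mul_of_nonneg_left h3 (by linarith)
      simp only [measureReal_zero, Pi.zero_apply, mul_zero, sub_zero]
      nlinarith
  intro x y
  rw [abs_sub_le_iff]
  refine ⟨one_sided x y, ?_⟩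
  rw [add_comm (V x)]
  exact one_sided y x

/-- A sequence of probability measures that is Cauchy uniformly over measurable sets converges,
uniformly over measurable sets, to a probability measure. -/
lemma exists_uniform_setwise_limit (m : ℕ → Measure α) [∀ n, IsProbabilityMeasure (m n)]
    {ε : ℕ → ℝ} (hε : Tendsto ε atTop (nhds 0))
    (h : ∀ n k B, MeasurableSet B → |(m (n + k)).real B - (m n).real B| ≤ ε n) :
    ∃ π : Measure α, IsProbabilityMeasure π ∧
      ∀ n B, MeasurableSet B → |(m n).real B - π.real B| ≤ ε n := by
  have hlim : ∀ B, ∃ l : ℝ, MeasurableSet B → Tendsto (fun n => (m n).real B) atTop (nhds l) := by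
    intro B
    by_cases hB : MeasurableSet B
    · have : CauchySeq fun n => (m n).real B := by
        refine cauchySeq_of_le_tendsto_0' ε (fun n k hnk => ?_) hε
        obtain ⟨j, rfl⟩ := Nat.exists_eq_add_of_le hnk
        rw [dist_comm]
        exact h n j B hB
      obtain ⟨l, hl⟩ := cauchySeq_tendsto_of_complete this
      exact ⟨l, fun _ => hl⟩
    · exact ⟨0, fun hB' => absurd hB' hB⟩
  choose p hp using hlim
  have hp0 : ∀ B, MeasurableSet B → 0 ≤ p B := fun B hB =>
    ge_of_tendsto' (hp B hB) fun n => measureReal_nonneg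
  have hunif : ∀ n B, MeasurableSet B → |(m n).real B - p B| ≤ ε n := by
    intro n B hB
    have h1 : Tendsto (fun k => |(m (n + k)).real B - (m n).real B|) atTop
        (nhds |p B - (m n).real B|) :=
      (((hp B hB).comp (tendsto_add_atTop_nat n |>.congr fun k => add_comm k n)).sub_const _).abs
    rw [abs_sub_comm]
    exact le_of_tendsto' h1 fun k => h n k B hB
  have hsum : ∀ f : ℕ → Set α, (∀ i, MeasurableSet (f i)) → Pairwise (Function.onFun Disjoint f) →
      HasSum (fun i => p (f i)) (p (⋃ i, f i)) := by
    intro f hf hd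
    rw [hasSum_iff_tendsto_nat_of_nonneg (fun i => hp0 _ (hf i))]
    have hpart : ∀ n k, ∑ i ∈ Finset.range k, (m n).real (f i)
        = (m n).real (⋃ i ∈ Finset.range k, f i) := fun n k =>
      (measureReal_biUnion_finset (fun i _ j _ hij => hd hij) fun i _ => hf i).symm
    have hpp : ∀ k, ∑ i ∈ Finset.range k, p (f i) = p (⋃ i ∈ Finset.range k, f i) := by
      intro k
      refine tendsto_nhds_unique (tendsto_finsetSum _ fun i _ => hp (f i) (hf i)) ?_
      simp_rw [hpart]
      exact hp _ (Finset.measurableSet_biUnion _ fun i _ => hf i)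
    refine TendstoUniformly.tendsto_of_eventually_tendsto (p := atTop)
      (F := fun n k => ∑ i ∈ Finset.range k, (m n).real (f i))
      (L := fun n => (m n).real (⋃ i, f i)) ?_ (Eventually.of_forall fun n => ?_)
      (hp _ (MeasurableSet.iUnion hf))
    · rw [Metric.tendstoUniformly_iff]
      intro δ hδ
      filter_upwards [hε.eventually (gt_mem_nhds hδ)] with n hn k
      rw [hpart, hpp, dist_comm]
      exact (hunif n _ (Finset.measurableSet_biUnion _ fun i _ => hf i)).trans_lt hn
    · have h1 : HasSum (fun i => (m n).real (f i)) ((m n).real (⋃ i, f i)) := by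
        have h2 := measure_iUnion (μ := m n) hd hf
        have h3 : ∑' i, m n (f i) ≠ ⊤ := h2 ▸ measure_ne_top _ _
        rw [measureReal_def, h2, ENNReal.tsum_toReal_eq fun i => measure_ne_top _ _]
        exact ENNReal.hasSum_toReal h3
      exact h1.tendsto_sum_nat
  have hempty : p ∅ = 0 :=
    tendsto_nhds_unique (hp ∅ MeasurableSet.empty) (by simp)
  let π : Measure α := Measure.ofMeasurable (fun B _ => ENNReal.ofReal (p B)) (by simp [hempty])
    (fun f hf hd => by
      rw [← (hsum f hf hd).tsum_eq,
        ENNReal.ofReal_tsum_of_nonneg (fun i => hp0 _ (hf i)) (hsum f hf hd).summable])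
  have hπ : ∀ B, MeasurableSet B → π B = ENNReal.ofReal (p B) := fun B hB =>
    Measure.ofMeasurable_apply B hB
  refine ⟨π, ⟨?_⟩, fun n B hB => ?_⟩
  · have : p Set.univ = 1 := tendsto_nhds_unique (hp _ MeasurableSet.univ) (by simp)
    rw [hπ _ MeasurableSet.univ, this, ENNReal.ofReal_one]
  · rw [measureReal_def π, hπ B hB, ENNReal.toReal_ofReal (hp0 B hB)]
    exact hunif n B hB

lemma IsUnitTest.abs_integral_sub_integral_le {φ : α → ℝ} (hφ : IsUnitTest φ) {p q : Measure α}
    [IsProbabilityMeasure p] [IsProbabilityMeasure q] {ε : ℝ}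
    (h : ∀ B, MeasurableSet B → |p.real B - q.real B| ≤ ε) :
    |∫ x, φ x ∂p - ∫ x, φ x ∂q| ≤ ε := by
  have layer : ∀ (m : Measure α) [IsProbabilityMeasure m],
      ∫ x, φ x ∂m = ∫ t in Set.Ioc (0 : ℝ) 1, m.real {x | t ≤ φ x} := fun m _ =>
    (hφ.integrable m).integral_eq_integral_Ioc_meas_le (ae_of_all _ hφ.nonneg)
      (ae_of_all _ hφ.le_one)
  have int : ∀ (m : Measure α) [IsProbabilityMeasure m],
      IntegrableOn (fun t : ℝ => m.real {x | t ≤ φ x}) (Set.Ioc 0 1) := by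
    intro m _
    have : Antitone fun t : ℝ => m.real {x | t ≤ φ x} := fun s t hst =>
      measureReal_mono fun x hx => le_trans hst hx
    refine Integrable.of_bound this.measurable.aestronglyMeasurable 1 (ae_of_all _ fun t => ?_)
    rw [Real.norm_eq_abs, abs_of_nonneg measureReal_nonneg]
    exact measureReal_le_one
  rw [layer p, layer q, ← integral_sub (int p) (int q)]
  have := norm_setIntegral_le_of_norm_le_const (μ := volume) (s := Set.Ioc (0 : ℝ) 1) (C := ε)
    (f := fun t : ℝ => p.real {x | t ≤ φ x} - q.real {x | t ≤ φ x}) (by simp)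
    (fun t _ => h _ (measurableSet_le measurable_const hφ.measurable))
  simpa using this

lemma integrable_bind_of_drift (Q : Kernel α α) [IsMarkovKernel Q] {V : α → ℝ}
    (hVm : Measurable V) (hV0 : ∀ x, 0 ≤ V x) {γ C : ℝ}
    (hVi : ∀ x, Integrable V (Q x)) (hdrift : ∀ x, ∫ y, V y ∂Q x ≤ γ * V x + C)
    (ρ : Measure α) [IsProbabilityMeasure ρ] (hρ : Integrable V ρ) :
    Integrable V (ρ.bind Q) ∧ ∫ x, V x ∂(ρ.bind Q) ≤ γ * ∫ x, V x ∂ρ + C := by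
  have hn : ∀ x, ∫ y, ‖V y‖ ∂Q x = ∫ y, V y ∂Q x := fun x =>
    integral_congr_ae (ae_of_all _ fun y => by simp [abs_of_nonneg (hV0 y)])
  have hbound : Integrable (fun x => γ * V x + C) ρ :=
    (hρ.const_mul γ).add (integrable_const C)
  have hint : Integrable (fun x => ∫ y, V y ∂Q x) ρ := by
    refine hbound.mono' hVm.stronglyMeasurable.integral_kernel.aestronglyMeasurable
      (ae_of_all _ fun x => ?_)
    rw [Real.norm_eq_abs, abs_of_nonneg (integral_nonneg hV0)]
    exact hdrift x
  have hi : Integrable V (ρ.bind Q) := by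
    rw [Measure.integrable_comp_iff hVm.aestronglyMeasurable]
    exact ⟨ae_of_all _ hVi, by simpa only [hn] using hint⟩
  refine ⟨hi, ?_⟩
  have : ∫ x, V x ∂(ρ.bind Q) = ∫ x, ∫ y, V y ∂Q x ∂ρ := by
    rw [Measure.comp_eq_comp_const_apply] at hi ⊢
    rw [Kernel.integral_comp hi]
    simp
  rw [this]
  calc ∫ x, ∫ y, V y ∂Q x ∂ρ ≤ ∫ x, (γ * V x + C) ∂ρ := integral_mono hint hbound hdrift
    _ = γ * ∫ x, V x ∂ρ + C := by
      rw [integral_add (hρ.const_mul γ) (integrable_const C), integral_const_mul]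
      simp

lemma isProbabilityMeasure_iterate_bind (Q : Kernel α α) [IsMarkovKernel Q] (ρ : Measure α)
    [hρ : IsProbabilityMeasure ρ] (n : ℕ) :
    IsProbabilityMeasure ((fun m : Measure α => m.bind Q)^[n] ρ) := by
  induction n generalizing ρ with
  | zero => exact hρ
  | succ n ih => exact ih (ρ.bind Q)

/-- Harris' ergodic theorem: under a geometric drift condition and a one-step minorization on
sublevel sets, the chain has an invariant probability measure to which all initial laws converge,
uniformly over measurable sets. -/
theorem exists_invariant_of_drift_of_minorization [Nonempty α] (Q : Kernel α α) [IsMarkovKernel Q]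
    {V : α → ℝ} (hVm : Measurable V) (hV0 : ∀ x, 0 ≤ V x) {γ C : ℝ} (hγ0 : 0 ≤ γ) (hγ : γ < 1)
    (hC : 0 < C) (hVi : ∀ x, Integrable V (Q x)) (hdrift : ∀ x, ∫ y, V y ∂Q x ≤ γ * V x + C)
    (hminor : ∀ R : ℝ, ∃ ν : Measure α, IsFiniteMeasure ν ∧ ν ≠ 0 ∧ ∀ x, V x ≤ R → ν ≤ Q x) :
    ∃ π : Measure α, IsProbabilityMeasure π ∧ π.bind Q = π ∧
      ∀ ρ : Measure α, IsProbabilityMeasure ρ → ∀ ε : ℝ, 0 < ε → ∀ᶠ n in atTop,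
        ∀ B, MeasurableSet B →
          |((fun m : Measure α => m.bind Q)^[n] ρ).real B - π.real B| ≤ ε := by
  obtain ⟨β, a, hβ, ha0, ha1, hcontr⟩ :=
    exists_contraction Q hV0 hγ0 hγ hC hVi hdrift hminor
  set F : Measure α → Measure α := fun m => m.bind Q with hF
  set T : (α → ℝ) → (α → ℝ) := fun φ x => ∫ y, φ y ∂Q x with hT
  have hFp : ∀ (ρ : Measure α) [IsProbabilityMeasure ρ] n, IsProbabilityMeasure (F^[n] ρ) :=
    fun ρ _ n => isProbabilityMeasure_iterate_bind Q ρ n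
  have hTu : ∀ φ, IsUnitTest φ → ∀ n, IsUnitTest (T^[n] φ) := by
    intro φ hφ n
    induction n with
    | zero => exact hφ
    | succ n ih => rw [Function.iterate_succ_apply']; exact ih.integral_kernel Q
  have hdual : ∀ φ, IsUnitTest φ → ∀ n (ρ : Measure α) [IsProbabilityMeasure ρ],
      ∫ x, φ x ∂(F^[n] ρ) = ∫ x, T^[n] φ x ∂ρ := by
    intro φ hφ n
    induction n with
    | zero => intro ρ _; rfl
    | succ n ih =>
      intro ρ _
      rw [Function.iterate_succ_apply, ih (F ρ), Function.iterate_succ_apply']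
      exact (hTu φ hφ n).integral_bind Q ρ
  have hdecay : ∀ φ, IsUnitTest φ → ∀ n x y,
      |T^[n] φ x - T^[n] φ y| ≤ a ^ n * (2 + β * (V x + V y)) := by
    intro φ hφ n
    induction n with
    | zero =>
      intro x y
      have := mul_nonneg hβ.le (add_nonneg (hV0 x) (hV0 y))
      have := hφ.abs_sub_le_one x y
      simp only [Function.iterate_zero, id, pow_zero, one_mul]
      linarith
    | succ n ih =>
      rw [Function.iterate_succ_apply', pow_succ']
      exact hcontr _ (hTu φ hφ n) _ (pow_nonneg ha0 n) ih
  obtain ⟨x₀⟩ := ‹Nonempty α›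
  set K : ℝ := V x₀ + C / (1 - γ) with hK
  have hKγ : γ * K + C ≤ K := by
    have : (1 - γ) * (C / (1 - γ)) = C := by field_simp [show (1 - γ) ≠ 0 by linarith]
    have h1 : 0 ≤ (1 - γ) * V x₀ := mul_nonneg (by linarith) (hV0 x₀)
    rw [hK]; nlinarith
  set m : ℕ → Measure α := fun n => F^[n] (Measure.dirac x₀) with hm
  have hmp : ∀ n, IsProbabilityMeasure (m n) := fun n => hFp _ n
  have hmV : ∀ n, Integrable V (m n) ∧ ∫ x, V x ∂(m n) ≤ K := by
    intro n
    induction n with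
    | zero =>
      refine ⟨?_, ?_⟩
      · exact (integrable_dirac' hVm.stronglyMeasurable (by simp))
      · change ∫ x, V x ∂(Measure.dirac x₀) ≤ K
        rw [integral_dirac' _ _ hVm.stronglyMeasurable]
        have : 0 ≤ C / (1 - γ) := div_nonneg hC.le (by linarith)
        linarith
    | succ n ih =>
      have e : m (n + 1) = (m n).bind Q := by simp only [hm, Function.iterate_succ_apply', hF]
      rw [e]
      obtain ⟨h1, h2⟩ := integrable_bind_of_drift Q hVm hV0 hVi hdrift (m n) ih.1
      exact ⟨h1, h2.trans (le_trans (by gcongr; exact ih.2) hKγ)⟩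
  have hreal : ∀ (ρ : Measure α) [IsProbabilityMeasure ρ] n B, MeasurableSet B →
      (F^[n] ρ).real B = ∫ x, T^[n] (B.indicator fun _ => (1 : ℝ)) x ∂ρ := by
    intro ρ _ n B hB
    rw [← hdual _ (IsUnitTest.indicator hB), integral_indicator hB]
    simp
  have hTx₀ : ∀ n B, MeasurableSet B →
      (m n).real B = T^[n] (B.indicator fun _ => (1 : ℝ)) x₀ := by
    intro n B hB
    rw [hm, hreal _ n B hB, integral_dirac' _ _
      (hTu _ (IsUnitTest.indicator hB) n).measurable.stronglyMeasurable]
  set D : ℝ := 2 + β * (K + V x₀) with hD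
  have hadecay : Tendsto (fun n : ℕ => a ^ n) atTop (nhds 0) :=
    tendsto_pow_atTop_nhds_zero_of_lt_one ha0 ha1
  obtain ⟨π, hπp, hπ⟩ := exists_uniform_setwise_limit m (ε := fun n => a ^ n * D)
    (by simpa using hadecay.mul_const D) (by
      intro n k B hB
      have e : m (n + k) = F^[n] (m k) := Function.iterate_add_apply F n k _
      have hu := hTu _ (IsUnitTest.indicator hB) n
      have e2 : T^[n] (B.indicator fun _ => (1 : ℝ)) x₀
          = ∫ _, T^[n] (B.indicator fun _ => (1 : ℝ)) x₀ ∂(m k) := by simp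
      rw [e, hreal _ n B hB, hTx₀ n B hB, e2, ← integral_sub (hu.integrable _)
        (integrable_const _)]
      have hβV := (hmV k).1.const_mul β
      have hsplit : ∀ x, a ^ n * (2 + β * (V x + V x₀))
          = a ^ n * ((2 + β * V x₀) + β * V x) := fun x => by ring
      have hi : Integrable (fun x => a ^ n * (2 + β * (V x + V x₀))) (m k) := by
        simp_rw [hsplit]
        exact ((integrable_const _).add hβV).const_mul _
      refine (abs_integral_le_integral_abs).trans ((integral_mono
        ((hu.integrable _).sub (integrable_const _)).abs hi
        fun x => hdecay _ (IsUnitTest.indicator hB) n x x₀).trans ?_)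
      simp_rw [hsplit]
      rw [integral_const_mul, integral_add (integrable_const _) hβV, integral_const_mul,
        integral_const, probReal_univ, one_smul]
      refine mul_le_mul_of_nonneg_left ?_ (pow_nonneg ha0 n)
      have := mul_le_mul_of_nonneg_left (hmV k).2 hβ.le
      linarith)
  refine ⟨π, hπp, ?_, fun ρ hρ ε hε => ?_⟩
  · ext B hB
    rw [← measureReal_eq_measureReal_iff]
    have hB1 := IsUnitTest.indicator hB
    have h1 : Tendsto (fun n => (m (n + 1)).real B) atTop (nhds (π.real B)) := by
      rw [tendsto_iff_norm_sub_tendsto_zero]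
      refine squeeze_zero (fun n => norm_nonneg _) (fun n => hπ (n + 1) B hB) ?_
      simpa using ((tendsto_add_atTop_iff_nat 1).2 hadecay).mul_const D
    have h2 : Tendsto (fun n => (m (n + 1)).real B) atTop (nhds ((π.bind Q).real B)) := by
      rw [tendsto_iff_norm_sub_tendsto_zero]
      refine squeeze_zero (fun n => norm_nonneg _) (fun n => ?_)
        (by simpa using hadecay.mul_const D)
      have e : m (n + 1) = F^[1] (m n) := by
        simp only [hm, Function.iterate_succ_apply', Function.iterate_zero, id]
      rw [e, hreal _ 1 B hB, show π.bind Q = F^[1] π from rfl, hreal _ 1 B hB]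
      exact (hTu _ hB1 1).abs_integral_sub_integral_le (hπ n)
    exact tendsto_nhds_unique h2 h1
  · have hK0 : 0 ≤ K := by
      have : 0 ≤ C / (1 - γ) := div_nonneg hC.le (by linarith)
      linarith [hV0 x₀]
    have hD0 : 0 ≤ D := by have := mul_nonneg hβ.le (add_nonneg hK0 (hV0 x₀)); linarith
    set H : α → ℝ := fun x => 2 + β * (V x + V x₀) + D with hH
    have hHm : Measurable H := by fun_prop
    have hH0 : ∀ x, 0 ≤ H x := fun x => by
      have := mul_nonneg hβ.le (add_nonneg (hV0 x) (hV0 x₀))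
      simp only [hH]; linarith
    have hmin0 : ∀ n x, 0 ≤ min 1 (a ^ n * H x) := fun n x =>
      le_min zero_le_one (mul_nonneg (pow_nonneg ha0 n) (hH0 x))
    have hminm : ∀ n, Measurable fun x => min 1 (a ^ n * H x) := fun n =>
      measurable_const.min (hHm.const_mul _)
    have hminb : ∀ n x, ‖min 1 (a ^ n * H x)‖ ≤ 1 := fun n x => by
      rw [Real.norm_eq_abs, abs_of_nonneg (hmin0 n x)]
      exact min_le_left _ _
    have hconv : Tendsto (fun n : ℕ => ∫ x, min 1 (a ^ n * H x) ∂ρ) atTop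
        (nhds (∫ _, (0 : ℝ) ∂ρ)) := by
      refine tendsto_integral_of_dominated_convergence (fun _ => (1 : ℝ))
        (fun n => (hminm n).aestronglyMeasurable)
        (integrable_const _) (fun n => ae_of_all _ (hminb n)) (ae_of_all _ fun x => ?_)
      have : Tendsto (fun n : ℕ => min 1 (a ^ n * H x)) atTop (nhds (min 1 (0 * H x))) :=
        tendsto_const_nhds.min (hadecay.mul_const _)
      simpa using this
    rw [integral_zero] at hconv
    filter_upwards [hconv.eventually (gt_mem_nhds hε)] with n hn B hB
    have hB1 := IsUnitTest.indicator hB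
    have hu := hTu _ hB1 n
    have hπ1 : π.real B = ∫ _, π.real B ∂ρ := by simp
    rw [hreal ρ n B hB, hπ1, ← integral_sub (hu.integrable _) (integrable_const _)]
    refine abs_integral_le_integral_abs.trans (le_trans (integral_mono
      ((hu.integrable _).sub (integrable_const _)).abs
      (Integrable.of_bound (hminm n).aestronglyMeasurable 1 (ae_of_all _ (hminb n)))
      fun x => le_min ?_ ?_) hn.le)
    · have h1 : π.real B ≤ 1 := measureReal_le_one
      have h2 : 0 ≤ π.real B := measureReal_nonneg
      rw [abs_sub_le_iff]
      constructor <;> linarith [hu.nonneg x, hu.le_one x]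
    · have h1 := hdecay _ hB1 n x x₀
      have h2 := hπ n B hB
      rw [hTx₀ n B hB] at h2
      refine (abs_sub_le _ _ _).trans ((add_le_add h1 h2).trans_eq ?_)
      simp only [hH]
      ring

end Harris

section TwoStep

variable {α : Type*} [MeasurableSpace α]

lemma eq_of_invariant_of_convergence (F : Measure α → Measure α) {π π' : Measure α}
    [IsProbabilityMeasure π] [IsProbabilityMeasure π'] (hπ' : F π' = π')
    (h : ∀ ε : ℝ, 0 < ε → ∀ᶠ n in atTop, ∀ B, MeasurableSet B →
      |(F^[n] π').real B - π.real B| ≤ ε) : π' = π := by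
  ext B hB
  rw [← measureReal_eq_measureReal_iff]
  refine eq_of_abs_sub_le_all fun ε hε => ?_
  obtain ⟨n, hn⟩ := (h ε hε).exists
  have := hn B hB
  rwa [Function.iterate_fixed hπ'] at this

/-- Harris' ergodic theorem with a one-step drift condition and a two-step minorization. -/
theorem exists_invariant_of_drift_of_two_step_minorization [Nonempty α] (κ : Kernel α α)
    [IsMarkovKernel κ] {V : α → ℝ} (hVm : Measurable V) (hV0 : ∀ x, 0 ≤ V x) {γ C : ℝ}
    (hγ0 : 0 ≤ γ) (hγ : γ < 1) (hC : 0 < C) (hVi : ∀ x, Integrable V (κ x))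
    (hdrift : ∀ x, ∫ y, V y ∂κ x ≤ γ * V x + C)
    (hminor : ∀ R : ℝ, ∃ ν : Measure α,
      IsFiniteMeasure ν ∧ ν ≠ 0 ∧ ∀ x, V x ≤ R → ν ≤ (κ ∘ₖ κ) x) :
    ∃ π : Measure α, IsProbabilityMeasure π ∧ π.bind κ = π ∧
      ∀ ρ : Measure α, IsProbabilityMeasure ρ → ∀ ε : ℝ, 0 < ε → ∀ᶠ n in atTop,
        ∀ B, MeasurableSet B →
          |((fun m : Measure α => m.bind κ)^[n] ρ).real B - π.real B| ≤ ε := by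
  have hint : ∀ x, Integrable V ((κ ∘ₖ κ) x) ∧
      ∫ y, V y ∂(κ ∘ₖ κ) x ≤ γ ^ 2 * V x + (γ * C + C) := fun x => by
    obtain ⟨h1, h2⟩ := integrable_bind_of_drift κ hVm hV0 hVi hdrift (κ x) (hVi x)
    rw [← Kernel.comp_apply] at h1 h2
    refine ⟨h1, h2.trans ?_⟩
    have := mul_le_mul_of_nonneg_left (hdrift x) hγ0
    linarith
  obtain ⟨π, hπp, hπ, hconv⟩ := exists_invariant_of_drift_of_minorization (κ ∘ₖ κ) hVm hV0
    (sq_nonneg γ) (by nlinarith) (by positivity) (fun x => (hint x).1) (fun x => (hint x).2) hminor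
  set F : Measure α → Measure α := fun m => m.bind κ with hF
  have hF2 : (fun m : Measure α => m.bind (κ ∘ₖ κ)) = F^[2] := by
    funext m
    simp only [hF, Function.iterate_succ, Function.iterate_zero, Function.comp, id]
    exact Measure.comp_assoc.symm
  rw [hF2] at hconv
  have hFπ : IsProbabilityMeasure (F π) := isProbabilityMeasure_iterate_bind κ π 1
  have hπ2 : F^[2] π = π := by rw [← hF2]; exact hπ
  have hinv : F π = π := by
    refine eq_of_invariant_of_convergence F^[2] ?_ (hconv (F π) hFπ)
    rw [← Function.iterate_succ_apply, Function.iterate_succ_apply', hπ2]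
  refine ⟨π, hπp, hinv, fun ρ hρ ε hε => ?_⟩
  have hFρ : IsProbabilityMeasure (F ρ) := isProbabilityMeasure_iterate_bind κ ρ 1
  obtain ⟨N₁, hN₁⟩ := eventually_atTop.1 (hconv ρ hρ ε hε)
  obtain ⟨N₂, hN₂⟩ := eventually_atTop.1 (hconv (F ρ) hFρ ε hε)
  filter_upwards [eventually_ge_atTop (2 * (N₁ + N₂) + 1)] with n hn B hB
  obtain ⟨k, rfl | rfl⟩ := Nat.even_or_odd' n
  · rw [Function.iterate_mul]
    exact hN₁ k (by omega) B hB
  · rw [Function.iterate_succ_apply, Function.iterate_mul]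
    exact hN₂ k (by omega) B hB

end TwoStep

lemma isProbabilityMeasure_noise (sigma : ℝ) : IsProbabilityMeasure (noise sigma) := by
  unfold noise; infer_instance

lemma integrable_exp_mul_noise (sigma t : ℝ) :
    Integrable (fun n => Real.exp (t * n)) (noise sigma) := by
  by_contra h
  have h1 := mgf_undef (X := fun n : ℝ => n) (μ := noise sigma) (t := t) h
  rw [noise, mgf_fun_id_gaussianReal] at h1
  exact (Real.exp_pos _).ne' h1

lemma integral_exp_mul_noise (sigma t : ℝ) :
    ∫ n, Real.exp (t * n) ∂(noise sigma) = Real.exp (sigma ^ 2 * t ^ 2 / 2) := by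
  have h := congrFun (mgf_fun_id_gaussianReal (μ := 0) (v := (sigma ^ 2).toNNReal)) t
  rw [mgf] at h
  rw [noise, h, Real.coe_toNNReal _ (sq_nonneg sigma)]
  simp

/-- Translates of the noise have a Lebesgue density bounded below, locally uniformly. -/
lemma exists_smul_restrict_le_map_noise {sigma : ℝ} (hsigma : 0 < sigma) (D : ℝ) :
    ∃ c : ENNReal, c ≠ 0 ∧ c ≠ ⊤ ∧ ∀ m a b : ℝ, (∀ s ∈ Set.Icc a b, |s - m| ≤ D) →
      c • volume.restrict (Set.Icc a b) ≤ (noise sigma).map (m + ·) := by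
  set v := (sigma ^ 2).toNNReal with hv
  have hv0 : v ≠ 0 := by
    rw [hv, Ne, Real.toNNReal_eq_zero, not_le]; positivity
  have hvpos : (0 : ℝ) < v := by positivity
  refine ⟨ENNReal.ofReal ((√(2 * Real.pi * v))⁻¹ * Real.exp (-D ^ 2 / (2 * v))), ?_,
    ENNReal.ofReal_ne_top, fun m a b h => ?_⟩
  · rw [Ne, ENNReal.ofReal_eq_zero, not_le]
    positivity
  rw [noise, gaussianReal_map_const_add, zero_add, gaussianReal_of_var_ne_zero _ hv0,
    Measure.le_iff]
  intro s hs
  rw [Measure.smul_apply, Measure.restrict_apply hs, withDensity_apply _ hs, smul_eq_mul,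
    ← setLIntegral_const]
  refine le_trans (setLIntegral_mono' (hs.inter measurableSet_Icc) fun x hx => ?_)
    (lintegral_mono_set Set.inter_subset_left)
  refine ENNReal.ofReal_le_ofReal ?_
  rw [gaussianPDFReal]
  have h1 : (x - m) ^ 2 ≤ D ^ 2 := sq_le_sq' (abs_le.1 (h x hx.2)).1 (abs_le.1 (h x hx.2)).2
  gcongr

section Policy

variable {lam mu zeta xi rstar sigma : ℝ}

lemma step_eq (p : ℝ × ℝ) (n : ℝ) :
    step lam mu zeta xi rstar p n
      = ((step lam mu zeta xi rstar p 0).1 + n, (step lam mu zeta xi rstar p 0).2) := by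
  simp [step]

lemma measurable_step : Measurable fun q : (ℝ × ℝ) × ℝ => step lam mu zeta xi rstar q.1 q.2 := by
  unfold step
  fun_prop

lemma measurable_step_right (p : ℝ × ℝ) : Measurable (step lam mu zeta xi rstar p) :=
  measurable_step.comp measurable_prodMk_left

lemma step_snd_nonneg (hlm : lam + mu < 1) {p : ℝ × ℝ} (hp : 0 ≤ p.2) (n : ℝ) :
    0 ≤ (step lam mu zeta xi rstar p n).2 :=
  add_nonneg (le_max_right _ _) (mul_nonneg (by linarith) hp)

lemma measurable_kerP : Measurable (kerP lam mu zeta xi rstar sigma) := by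
  have := isProbabilityMeasure_noise sigma
  refine Measure.measurable_of_measurable_coe _ fun s hs => ?_
  have h : ∀ p, kerP lam mu zeta xi rstar sigma p s = noise sigma (Prod.mk p ⁻¹'
      ((fun q : (ℝ × ℝ) × ℝ => step lam mu zeta xi rstar q.1 q.2) ⁻¹' s)) :=
    fun p => Measure.map_apply (measurable_step_right p) hs
  simp_rw [h]
  exact measurable_measure_prodMk_left (measurable_step hs)

lemma measurable_kerPn (n : ℕ) : Measurable (kerPn lam mu zeta xi rstar sigma n) := by
  induction n with
  | zero => exact Measure.measurable_dirac
  | succ n ih => exact (Measure.measurable_bind' ih).comp measurable_kerP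

/-- The projection of the plane onto the state space. -/
def clip (p : ℝ × ℝ) : ℝ × ℝ := (p.1, max p.2 0)

lemma measurable_clip : Measurable clip := by unfold clip; fun_prop

lemma clip_snd_nonneg (p : ℝ × ℝ) : 0 ≤ (clip p).2 := le_max_right _ _

lemma clip_of_nonneg {p : ℝ × ℝ} (hp : 0 ≤ p.2) : clip p = p := Prod.ext rfl (max_eq_left hp)

/-- The transition kernel on the whole plane that starts by projecting onto the state space. -/
noncomputable def clippedKernel (lam mu zeta xi rstar sigma : ℝ) : Kernel (ℝ × ℝ) (ℝ × ℝ) where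
  toFun p := kerP lam mu zeta xi rstar sigma (clip p)
  measurable' := measurable_kerP.comp measurable_clip

lemma clippedKernel_apply (p : ℝ × ℝ) : clippedKernel lam mu zeta xi rstar sigma p
    = (noise sigma).map (step lam mu zeta xi rstar (clip p)) := rfl

instance : IsMarkovKernel (clippedKernel lam mu zeta xi rstar sigma) :=
  ⟨fun p => by
    have := isProbabilityMeasure_noise sigma
    exact Measure.isProbabilityMeasure_map (measurable_step_right _).aemeasurable⟩

lemma measurableSet_snd_neg : MeasurableSet {p : ℝ × ℝ | p.2 < 0} :=
  measurableSet_lt measurable_snd measurable_const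

lemma bind_clippedKernel_snd_neg (hlm : lam + mu < 1) (ρ : Measure (ℝ × ℝ)) :
    ρ.bind (clippedKernel lam mu zeta xi rstar sigma) {p | p.2 < 0} = 0 := by
  rw [Measure.bind_apply measurableSet_snd_neg (Kernel.aemeasurable _)]
  have : ∀ p, clippedKernel lam mu zeta xi rstar sigma p {p | p.2 < 0} = 0 := by
    intro p
    rw [clippedKernel_apply, Measure.map_apply (measurable_step_right _) measurableSet_snd_neg]
    convert measure_empty (μ := noise sigma)
    ext n
    simpa using step_snd_nonneg hlm (clip_snd_nonneg p) n
  simp [this]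

lemma bind_kerP_eq {ρ : Measure (ℝ × ℝ)} (hρ : ρ {p | p.2 < 0} = 0) :
    ρ.bind (kerP lam mu zeta xi rstar sigma)
      = ρ.bind (clippedKernel lam mu zeta xi rstar sigma) := by
  refine Measure.bind_congr_right ?_
  have : ∀ᵐ p ∂ρ, ¬ p.2 < 0 := by
    rw [ae_iff]; simpa only [not_not] using hρ
  filter_upwards [this] with p hp
  change _ = kerP lam mu zeta xi rstar sigma (clip p)
  rw [clip_of_nonneg (not_lt.1 hp)]

lemma bind_kerPn_eq (hlm : lam + mu < 1) (n : ℕ) {ρ : Measure (ℝ × ℝ)}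
    (hρ : ρ {p | p.2 < 0} = 0) :
    ρ.bind (kerPn lam mu zeta xi rstar sigma n)
      = (fun m : Measure (ℝ × ℝ) => m.bind (clippedKernel lam mu zeta xi rstar sigma))^[n] ρ := by
  induction n generalizing ρ with
  | zero => exact Measure.bind_dirac
  | succ n ih =>
    rw [Function.iterate_succ_apply, ← ih (bind_clippedKernel_snd_neg hlm ρ), ← bind_kerP_eq hρ,
      Measure.bind_bind measurable_kerP.aemeasurable (measurable_kerPn n).aemeasurable]
    rfl

/-- The coordinate `R + λ Z` follows an additive recursion with bounded drift. -/
lemma inventory_step (p : ℝ × ℝ) (n : ℝ) :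
    (step lam mu zeta xi rstar p n).1 + lam * (step lam mu zeta xi rstar p n).2
      = p.1 + lam * p.2 + max (min zeta (rstar - p.1)) (-xi) + n := by
  simp only [step]; ring

lemma drift_mem_Icc (hzeta : 0 < zeta) (hxi : 0 < xi) (r : ℝ) :
    max (min zeta (rstar - r)) (-xi) ∈ Set.Icc (-xi) zeta :=
  ⟨le_max_right _ _, max_le (min_le_left _ _) (by linarith)⟩

lemma lower_drift (hlam : 0 < lam) (hzeta : 0 < zeta) (hxi : 0 < xi) (hrstar : zeta < rstar)
    {p : ℝ × ℝ} (hp : 0 ≤ p.2) :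
    p.1 + lam * p.2 + min zeta xi
        ≤ (step lam mu zeta xi rstar p 0).1 + lam * (step lam mu zeta xi rstar p 0).2 ∨
      -xi ≤ (step lam mu zeta xi rstar p 0).1 + lam * (step lam mu zeta xi rstar p 0).2 := by
  rw [inventory_step]
  have h0 : 0 ≤ lam * p.2 := mul_nonneg hlam.le hp
  by_cases h : p.1 < 0
  · left
    rw [min_eq_left (by linarith : zeta ≤ rstar - p.1), max_eq_left (by linarith)]
    linarith [min_le_left zeta xi]
  · right
    linarith [(drift_mem_Icc (rstar := rstar) hzeta hxi p.1).1]

lemma upper_drift (hlam : 0 < lam) (hzeta : 0 < zeta) (hxi : 0 < xi) (hrstar : zeta < rstar)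
    (hmu : 0 < mu) (hlm : lam + mu < 1) {p : ℝ × ℝ} (hp : 0 ≤ p.2) :
    (step lam mu zeta xi rstar p 0).1 + (lam + mu) * (step lam mu zeta xi rstar p 0).2
        ≤ p.1 + (lam + mu) * p.2 - min zeta xi ∨
      (step lam mu zeta xi rstar p 0).1 + (lam + mu) * (step lam mu zeta xi rstar p 0).2
        ≤ rstar + xi + (zeta + min zeta xi) / mu + zeta := by
  have hm0 : 0 < min zeta xi := lt_min hzeta hxi
  obtain ⟨hf1, hf2⟩ := drift_mem_Icc (rstar := rstar) hzeta hxi p.1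
  have hmul : mu * ((zeta + min zeta xi) / mu) = zeta + min zeta xi := by field_simp
  have hq0 : 0 < (zeta + min zeta xi) / mu := by positivity
  set c := (zeta + min zeta xi) / mu
  set f := max (min zeta (rstar - p.1)) (-xi) with hf
  by_cases h : p.1 < 0
  · have e : (step lam mu zeta xi rstar p 0).1 + (lam + mu) * (step lam mu zeta xi rstar p 0).2
        = (1 - mu) * (p.1 + (lam + mu) * p.2) + f := by
      simp only [step, max_eq_left (by linarith : (0 : ℝ) ≤ -p.1), hf]; ring
    rw [e]
    by_cases hQ : c ≤ p.1 + (lam + mu) * p.2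
    · left
      nlinarith
    · right
      push Not at hQ
      nlinarith [mul_le_mul_of_nonneg_left hQ.le (by linarith : 0 ≤ 1 - mu)]
  · push Not at h
    have e : (step lam mu zeta xi rstar p 0).1 + (lam + mu) * (step lam mu zeta xi rstar p 0).2
        = p.1 + (1 - mu) * ((lam + mu) * p.2) + f := by
      simp only [step, max_eq_right (by linarith : -p.1 ≤ (0 : ℝ)), hf]; ring
    rw [e]
    have hb : 0 ≤ (lam + mu) * p.2 := mul_nonneg (by linarith) hp
    by_cases hr : rstar + xi ≤ p.1
    · left
      have : f = -xi := max_eq_right ((min_le_right _ _).trans (by linarith))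
      rw [this]
      nlinarith [min_le_right zeta xi]
    · push Not at hr
      by_cases hQ : c ≤ (lam + mu) * p.2
      · left
        nlinarith
      · right
        push Not at hQ
        nlinarith

/-- A Lyapunov function for the chain: it controls `-(R + λ Z)` and `R + (λ + μ) Z`
exponentially. -/
noncomputable def lyapunov (lam mu d : ℝ) (p : ℝ × ℝ) : ℝ :=
  Real.exp (-d * (p.1 + lam * p.2)) + Real.exp (d * (p.1 + (lam + mu) * p.2))

lemma measurable_lyapunov (d : ℝ) : Measurable (lyapunov lam mu d) := by
  unfold lyapunov
  fun_prop

lemma lyapunov_step (d : ℝ) (p : ℝ × ℝ) (n : ℝ) :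
    lyapunov lam mu d (step lam mu zeta xi rstar p n)
      = Real.exp (-d * ((step lam mu zeta xi rstar p 0).1
            + lam * (step lam mu zeta xi rstar p 0).2)) * Real.exp (-d * n)
        + Real.exp (d * ((step lam mu zeta xi rstar p 0).1
            + (lam + mu) * (step lam mu zeta xi rstar p 0).2)) * Real.exp (d * n) := by
  rw [step_eq, lyapunov, ← Real.exp_add, ← Real.exp_add]
  ring_nf

lemma integrable_lyapunov_step (d : ℝ) (p : ℝ × ℝ) :
    Integrable (fun n => lyapunov lam mu d (step lam mu zeta xi rstar p n)) (noise sigma) := by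
  simp_rw [lyapunov_step]
  exact ((integrable_exp_mul_noise sigma (-d)).const_mul _).add
    ((integrable_exp_mul_noise sigma d).const_mul _)

lemma integral_lyapunov_step (d : ℝ) (p : ℝ × ℝ) :
    ∫ n, lyapunov lam mu d (step lam mu zeta xi rstar p n) ∂(noise sigma)
      = lyapunov lam mu d (step lam mu zeta xi rstar p 0) * Real.exp (sigma ^ 2 * d ^ 2 / 2) := by
  simp_rw [lyapunov_step d p]
  rw [integral_add ((integrable_exp_mul_noise sigma (-d)).const_mul _)
    ((integrable_exp_mul_noise sigma d).const_mul _), integral_const_mul, integral_const_mul,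
    integral_exp_mul_noise, integral_exp_mul_noise]
  simp only [neg_sq, mul_zero, Real.exp_zero]
  ring

lemma lyapunov_step_zero_le (hlam : 0 < lam) (hzeta : 0 < zeta) (hxi : 0 < xi)
    (hrstar : zeta < rstar) (hmu : 0 < mu) (hlm : lam + mu < 1) {d : ℝ} (hd : 0 < d)
    {p : ℝ × ℝ} (hp : 0 ≤ p.2) :
    lyapunov lam mu d (step lam mu zeta xi rstar p 0)
      ≤ Real.exp (-(d * min zeta xi)) * lyapunov lam mu d p
        + (Real.exp (d * xi)
          + Real.exp (d * (rstar + xi + (zeta + min zeta xi) / mu + zeta))) := by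
  have h1 : Real.exp (-d * ((step lam mu zeta xi rstar p 0).1
      + lam * (step lam mu zeta xi rstar p 0).2))
      ≤ Real.exp (-(d * min zeta xi)) * Real.exp (-d * (p.1 + lam * p.2))
        + Real.exp (d * xi) := by
    rw [← Real.exp_add]
    rcases lower_drift hlam hzeta hxi hrstar hp with h | h
    · refine le_add_of_le_of_nonneg (Real.exp_le_exp.2 ?_) (Real.exp_pos _).le
      nlinarith
    · refine le_add_of_nonneg_of_le (Real.exp_pos _).le (Real.exp_le_exp.2 ?_)
      nlinarith
  have h2 : Real.exp (d * ((step lam mu zeta xi rstar p 0).1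
      + (lam + mu) * (step lam mu zeta xi rstar p 0).2))
      ≤ Real.exp (-(d * min zeta xi)) * Real.exp (d * (p.1 + (lam + mu) * p.2))
        + Real.exp (d * (rstar + xi + (zeta + min zeta xi) / mu + zeta)) := by
    rw [← Real.exp_add]
    rcases upper_drift hlam hzeta hxi hrstar hmu hlm hp with h | h
    · refine le_add_of_le_of_nonneg (Real.exp_le_exp.2 ?_) (Real.exp_pos _).le
      nlinarith
    · refine le_add_of_nonneg_of_le (Real.exp_pos _).le (Real.exp_le_exp.2 ?_)
      exact mul_le_mul_of_nonneg_left h hd.le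
  rw [lyapunov, lyapunov]
  linarith

/-- The Lyapunov function satisfies a geometric drift condition. -/
lemma exists_lyapunov_drift (hlam : 0 < lam) (hzeta : 0 < zeta) (hxi : 0 < xi)
    (hrstar : zeta < rstar) (hsigma : 0 < sigma) (hmu : 0 < mu) (hlm : lam + mu < 1) :
    ∃ d γ C : ℝ, 0 < d ∧ 0 ≤ γ ∧ γ < 1 ∧ 0 < C ∧
      ∀ p : ℝ × ℝ, 0 ≤ p.2 →
        ∫ n, lyapunov lam mu d (step lam mu zeta xi rstar p n) ∂(noise sigma)
          ≤ γ * lyapunov lam mu d p + C := by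
  have hm : 0 < min zeta xi := lt_min hzeta hxi
  have hd : 0 < min zeta xi / sigma ^ 2 := by positivity
  have hds : sigma ^ 2 * (min zeta xi / sigma ^ 2) = min zeta xi := by field_simp
  set d := min zeta xi / sigma ^ 2
  refine ⟨d, Real.exp (-(d * min zeta xi)) * Real.exp (sigma ^ 2 * d ^ 2 / 2),
    (Real.exp (d * xi) + Real.exp (d * (rstar + xi + (zeta + min zeta xi) / mu + zeta)))
      * Real.exp (sigma ^ 2 * d ^ 2 / 2), hd, by positivity, ?_, by positivity, fun p hp => ?_⟩
  · rw [← Real.exp_add, Real.exp_lt_one_iff]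
    have : sigma ^ 2 * d ^ 2 = d * min zeta xi := by rw [← hds]; ring
    rw [this]
    nlinarith [mul_pos hd hm]
  · rw [integral_lyapunov_step]
    have := mul_le_mul_of_nonneg_right
      (lyapunov_step_zero_le hlam hzeta hxi hrstar hmu hlm hd hp)
      (Real.exp_pos (sigma ^ 2 * d ^ 2 / 2)).le
    linarith

/-- Sublevel sets of the Lyapunov function are bounded in the state space. -/
lemma exists_bound_of_lyapunov_le (hlam : 0 < lam) (hmu : 0 < mu) {d : ℝ} (hd : 0 < d) (R : ℝ) :
    ∃ K : ℝ, 0 ≤ K ∧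
      ∀ p : ℝ × ℝ, 0 ≤ p.2 → lyapunov lam mu d p ≤ R → |p.1| ≤ K ∧ p.2 ≤ K := by
  have hl : 0 ≤ |R| / d := by positivity
  have hdl : d * (|R| / d) = |R| := by field_simp
  set l := |R| / d
  have hz : 0 ≤ 2 * l / mu := by positivity
  have hmz : mu * (2 * l / mu) = 2 * l := by field_simp
  set z := 2 * l / mu
  have hlz : 0 ≤ lam * z := by positivity
  refine ⟨l + z + lam * z, by positivity, fun p hp h => ?_⟩
  have hexp : ∀ x : ℝ, Real.exp (d * x) ≤ R → x ≤ l := fun x hx => by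
    refine le_of_mul_le_mul_left ?_ hd
    rw [hdl]
    linarith [Real.add_one_le_exp (d * x), le_abs_self R]
  rw [lyapunov, neg_mul_comm] at h
  have h1 := hexp _ (le_trans (le_add_of_nonneg_right (Real.exp_pos _).le) h)
  have h2 := hexp _ (le_trans (le_add_of_nonneg_left (Real.exp_pos _).le) h)
  have hpz : p.2 ≤ z := by
    refine le_of_mul_le_mul_left ?_ hmu
    linarith
  have h3 : lam * p.2 ≤ lam * z := mul_le_mul_of_nonneg_left hpz hlam.le
  have h4 : 0 ≤ lam * p.2 := by positivity
  have h5 : 0 ≤ mu * p.2 := by positivity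
  exact ⟨abs_le.2 ⟨by linarith, by linarith⟩, by linarith⟩

lemma abs_step_zero_le (hlam : 0 < lam) (hzeta : 0 < zeta) (hxi : 0 < xi)
    (hmu : 0 < mu) (hlm : lam + mu < 1) {K : ℝ} {p : ℝ × ℝ} (hp : 0 ≤ p.2)
    (h1 : |p.1| ≤ K) (h2 : p.2 ≤ K) :
    |(step lam mu zeta xi rstar p 0).1| ≤ 3 * K + zeta + xi ∧
      (step lam mu zeta xi rstar p 0).2 ≤ 3 * K + zeta + xi := by
  obtain ⟨hf1, hf2⟩ := drift_mem_Icc (rstar := rstar) hzeta hxi p.1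
  obtain ⟨h3, h4⟩ := abs_le.1 h1
  have hK : 0 ≤ K := hp.trans h2
  have hm0 : 0 ≤ max (-p.1) 0 := le_max_right _ _
  have hm : max (-p.1) 0 ≤ K := max_le (by linarith) hK
  have h5 : lam * max (-p.1) 0 ≤ K := by nlinarith
  have h6 : 0 ≤ lam * max (-p.1) 0 := by positivity
  have h7 : 0 ≤ lam * (lam + mu) * p.2 := by positivity
  have h8 : lam * (lam + mu) * p.2 ≤ 1 * p.2 :=
    mul_le_mul_of_nonneg_right (by nlinarith) hp
  have h9 : (1 - lam - mu) * p.2 ≤ 1 * p.2 :=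
    mul_le_mul_of_nonneg_right (by linarith) hp
  simp only [step]
  exact ⟨abs_le.2 ⟨by linarith, by linarith⟩, by linarith⟩

/-- On bounded sets the two-step transition kernel dominates Lebesgue measure on a rectangle. -/
lemma exists_two_step_minorization (hlam : 0 < lam) (hzeta : 0 < zeta) (hxi : 0 < xi)
    (hsigma : 0 < sigma) (hmu : 0 < mu) (hlm : lam + mu < 1) {K : ℝ} (hK : 0 ≤ K) :
    ∃ ν : Measure (ℝ × ℝ), IsFiniteMeasure ν ∧ ν ≠ 0 ∧
      ∀ p : ℝ × ℝ, |(clip p).1| ≤ K → (clip p).2 ≤ K →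
        ν ≤ (clippedKernel lam mu zeta xi rstar sigma
          ∘ₖ clippedKernel lam mu zeta xi rstar sigma) p := by
  set b := 3 * K + zeta + xi with hb
  have hb0 : 0 ≤ b := by positivity
  set b' := 3 * (b + 1) + zeta + xi with hb'
  have hb'0 : 0 ≤ b' := by positivity
  obtain ⟨c, hc0, hct, hc⟩ := exists_smul_restrict_le_map_noise hsigma (b + 1 + b + b' + 1)
  refine ⟨(c * c) • (volume.restrict (Set.Icc (0 : ℝ) 1)).prod
    (volume.restrict (Set.Icc b (b + 1))), ?_, ?_, fun p hp1 hp2 => ?_⟩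
  · exact Measure.smul_finite _ (ENNReal.mul_ne_top hct hct)
  · intro h
    have := congrArg (fun m : Measure (ℝ × ℝ) => m (Set.univ ×ˢ Set.univ)) h
    rw [Measure.smul_apply, Measure.prod_prod] at this
    simp [hc0] at this
  obtain ⟨hg, hh⟩ := abs_step_zero_le (rstar := rstar) hlam hzeta hxi hmu hlm
    (clip_snd_nonneg p) hp1 hp2
  have hh0 : 0 ≤ (step lam mu zeta xi rstar (clip p) 0).2 :=
    step_snd_nonneg hlm (clip_snd_nonneg p) 0
  rw [← hb] at hg hh
  set g := (step lam mu zeta xi rstar (clip p) 0).1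
  set h := (step lam mu zeta xi rstar (clip p) 0).2
  set w := (1 - lam - mu) * h with hw
  have hw0 : 0 ≤ w := mul_nonneg (by linarith) hh0
  have hwb : w ≤ b := by nlinarith
  have hfirst : clippedKernel lam mu zeta xi rstar sigma p
      = ((noise sigma).map (g + ·)).map (fun r => (r, h)) := by
    rw [clippedKernel_apply, Measure.map_map (by fun_prop) (by fun_prop)]
    congr 1
    funext n
    exact step_eq _ _
  have hsecond : ∀ r ∈ Set.Icc (-(b + 1)) 0,
      c • (volume.restrict (Set.Icc (0 : ℝ) 1)).map (fun s => (s, w - r))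
        ≤ clippedKernel lam mu zeta xi rstar sigma (r, h) := by
    intro r hr
    have hcl : clip (r, h) = (r, h) := clip_of_nonneg hh0
    obtain ⟨hg', -⟩ := abs_step_zero_le (rstar := rstar) (p := (r, h)) (K := b + 1) hlam hzeta hxi
      hmu hlm hh0 (abs_le.2 ⟨hr.1, hr.2.trans (by linarith)⟩) (hh.trans (by linarith))
    rw [← hb'] at hg'
    have e2 : (step lam mu zeta xi rstar (r, h) 0).2 = w - r := by
      simp only [step, max_eq_left (neg_nonneg.2 hr.2), hw]; ring
    set g' := (step lam mu zeta xi rstar (r, h) 0).1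
    have e : clippedKernel lam mu zeta xi rstar sigma (r, h)
        = ((noise sigma).map (g' + ·)).map (fun s => (s, w - r)) := by
      rw [clippedKernel_apply, Measure.map_map (by fun_prop) (by fun_prop), hcl]
      congr 1
      funext n
      rw [step_eq, e2]
      rfl
    rw [e, ← Measure.map_smul]
    refine Measure.map_mono (hc g' 0 1 fun s hs => ?_) (by fun_prop)
    obtain ⟨h1, h2⟩ := abs_le.1 hg'
    exact abs_le.2 ⟨by linarith [hs.1], by linarith [hs.2]⟩
  rw [Measure.le_iff]
  intro B hB
  have hmB : Measurable fun z : ℝ => volume.restrict (Set.Icc (0 : ℝ) 1) ((fun s => (s, z)) ⁻¹' B) :=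
    measurable_measure_prodMk_right hB
  rw [Kernel.comp_apply' _ _ _ hB, hfirst,
    lintegral_map (Kernel.measurable_coe _ hB) (by fun_prop), Measure.smul_apply,
    Measure.prod_apply_symm hB, smul_eq_mul]
  calc c * c * ∫⁻ z in Set.Icc b (b + 1),
        volume.restrict (Set.Icc (0 : ℝ) 1) ((fun s => (s, z)) ⁻¹' B)
      = c * c * ∫⁻ r in (fun r => w - r) ⁻¹' Set.Icc b (b + 1),
        volume.restrict (Set.Icc (0 : ℝ) 1) ((fun s => (s, w - r)) ⁻¹' B) := by
        rw [(Measure.measurePreserving_sub_left volume w).setLIntegral_comp_preimage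
          measurableSet_Icc hmB]
    _ ≤ c * c * ∫⁻ r in Set.Icc (-(b + 1)) 0,
        volume.restrict (Set.Icc (0 : ℝ) 1) ((fun s => (s, w - r)) ⁻¹' B) := by
        refine mul_le_mul_right (lintegral_mono_set fun r hr => ?_) _
        simp only [Set.mem_preimage, Set.mem_Icc] at hr ⊢
        exact ⟨by linarith, by linarith⟩
    _ = c * ∫⁻ r in Set.Icc (-(b + 1)) 0,
        c * volume.restrict (Set.Icc (0 : ℝ) 1) ((fun s => (s, w - r)) ⁻¹' B) := by
        rw [lintegral_const_mul' _ _ hct, mul_assoc]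
    _ ≤ c * ∫⁻ r in Set.Icc (-(b + 1)) 0, clippedKernel lam mu zeta xi rstar sigma (r, h) B := by
        refine mul_le_mul_right (setLIntegral_mono' measurableSet_Icc fun r hr => ?_) _
        have := Measure.le_iff.1 (hsecond r hr) B hB
        rwa [Measure.smul_apply, Measure.map_apply (by fun_prop) hB, smul_eq_mul] at this
    _ = ∫⁻ r, clippedKernel lam mu zeta xi rstar sigma (r, h) B
          ∂(c • volume.restrict (Set.Icc (-(b + 1)) 0)) := by
        rw [lintegral_smul_measure, smul_eq_mul]
    _ ≤ ∫⁻ r, clippedKernel lam mu zeta xi rstar sigma (r, h) B ∂((noise sigma).map (g + ·)) := by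
        refine lintegral_mono' (hc g _ _ fun s hs => ?_) le_rfl
        obtain ⟨h1, h2⟩ := abs_le.1 hg
        exact abs_le.2 ⟨by linarith [hs.1], by linarith [hs.2]⟩

/-- The chain has an invariant law, to which all its laws converge uniformly over Borel sets. -/
lemma exists_invariant_clippedKernel (hlam : 0 < lam) (hzeta : 0 < zeta) (hxi : 0 < xi)
    (hrstar : zeta < rstar) (hsigma : 0 < sigma) (hmu : 0 < mu) (hlm : lam + mu < 1) :
    ∃ π : Measure (ℝ × ℝ), IsProbabilityMeasure π ∧
      π.bind (clippedKernel lam mu zeta xi rstar sigma) = π ∧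
      ∀ ρ : Measure (ℝ × ℝ), IsProbabilityMeasure ρ → ∀ ε : ℝ, 0 < ε → ∀ᶠ n in atTop,
        ∀ B, MeasurableSet B →
          |((fun m : Measure (ℝ × ℝ) =>
              m.bind (clippedKernel lam mu zeta xi rstar sigma))^[n] ρ).real B - π.real B| ≤ ε := by
  obtain ⟨d, γ, C, hd, hγ0, hγ, hC, hdrift⟩ :=
    exists_lyapunov_drift hlam hzeta hxi hrstar hsigma hmu hlm
  have hV : Measurable fun p => lyapunov lam mu d (clip p) :=
    (measurable_lyapunov d).comp measurable_clip
  have hclip : ∀ p n, clip (step lam mu zeta xi rstar (clip p) n)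
      = step lam mu zeta xi rstar (clip p) n :=
    fun p n => clip_of_nonneg (step_snd_nonneg hlm (clip_snd_nonneg p) n)
  refine exists_invariant_of_drift_of_two_step_minorization
    (clippedKernel lam mu zeta xi rstar sigma) (V := fun p => lyapunov lam mu d (clip p)) hV
    (fun p => (add_pos (Real.exp_pos _) (Real.exp_pos _)).le) hγ0 hγ hC (fun p => ?_) (fun p => ?_)
    fun R => ?_
  · rw [clippedKernel_apply, integrable_map_measure hV.aestronglyMeasurable
      (measurable_step_right _).aemeasurable]
    simp only [Function.comp_def, hclip]
    exact integrable_lyapunov_step d _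
  · rw [clippedKernel_apply, integral_map (measurable_step_right _).aemeasurable
      hV.aestronglyMeasurable]
    simp only [hclip]
    exact hdrift _ (clip_snd_nonneg p)
  · obtain ⟨K, hK, hbound⟩ := exists_bound_of_lyapunov_le hlam hmu hd R
    obtain ⟨ν, hν, hν0, h⟩ := exists_two_step_minorization (rstar := rstar) hlam hzeta hxi hsigma
      hmu hlm hK
    refine ⟨ν, hν, hν0, fun p hp => ?_⟩
    obtain ⟨h1, h2⟩ := hbound _ (clip_snd_nonneg p) hp
    exact h p h1 h2

lemma tvDist_nonneg (π π' : Measure (ℝ × ℝ)) : 0 ≤ tvDist π π' :=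
  Real.iSup_nonneg fun _ => abs_nonneg _

lemma tvDist_le {π π' : Measure (ℝ × ℝ)} {ε : ℝ}
    (h : ∀ B, MeasurableSet B → |π.real B - π'.real B| ≤ ε) : tvDist π π' ≤ ε := by
  have : Nonempty { B : Set (ℝ × ℝ) // MeasurableSet B } := ⟨⟨∅, MeasurableSet.empty⟩⟩
  exact ciSup_le fun B => h B.1 B.2

end Policy

/-- Theorem 3.1. If `μ > 0` (and `λ + μ < 1`), the Markov chain has a
unique invariant probability measure `π` on `S = ℝ × [0,∞)`, and for every initial
distribution `ρ` on `S`, `‖∫ρ(dx)Pⁿ(x,·) − π‖_TV → 0`. -/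
theorem stability_of_threshold_policy
    (lam mu zeta xi rstar sigma : ℝ)
    (hlam : 0 < lam) (hzeta : 0 < zeta) (hxi : 0 < xi) (hrstar : zeta < rstar)
    (hsigma : 0 < sigma) (hmu : 0 < mu) (hlm : lam + mu < 1) :
    ∃ π : Measure (ℝ × ℝ), IsProbabilityMeasure π ∧ π {p | p.2 < 0} = 0 ∧
      π.bind (kerP lam mu zeta xi rstar sigma) = π ∧
      (∀ π' : Measure (ℝ × ℝ), IsProbabilityMeasure π' → π' {p | p.2 < 0} = 0 →
        π'.bind (kerP lam mu zeta xi rstar sigma) = π' → π' = π) ∧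
      (∀ ρ : Measure (ℝ × ℝ), IsProbabilityMeasure ρ → ρ {p | p.2 < 0} = 0 →
        Tendsto (fun n => tvDist (ρ.bind (kerPn lam mu zeta xi rstar sigma n)) π)
          atTop (nhds 0)) := by
  obtain ⟨π, hπp, hπ, hconv⟩ :=
    exists_invariant_clippedKernel hlam hzeta hxi hrstar hsigma hmu hlm
  have hπ0 : π {p | p.2 < 0} = 0 := by
    rw [← hπ]; exact bind_clippedKernel_snd_neg hlm π
  refine ⟨π, hπp, hπ0, (bind_kerP_eq hπ0).trans hπ, fun π' hπ'p hπ'0 hπ' => ?_,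
    fun ρ hρp hρ0 => ?_⟩
  · rw [bind_kerP_eq hπ'0] at hπ'
    exact eq_of_invariant_of_convergence
      (fun m => m.bind (clippedKernel lam mu zeta xi rstar sigma)) hπ' (hconv π' hπ'p)
  · simp_rw [fun n => bind_kerPn_eq (zeta := zeta) (xi := xi) (rstar := rstar) (sigma := sigma)
      hlm n hρ0]
    rw [Metric.tendsto_nhds]
    intro ε hε
    filter_upwards [hconv ρ hρp (ε / 2) (half_pos hε)] with n hn
    rw [Real.dist_eq, sub_zero, abs_of_nonneg (tvDist_nonneg _ _)]
    exact (tvDist_le hn).trans_lt (half_lt_self hε)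
end

section
/- Suppose μ ≠ 0 and let x = (r,z) ∈ D1. With u = −(r + λz)/μ and v = (r + (λ+μ)z)/μ, the one-step drift of the Lyapunov function H satisfies the exact identity 𝒟H(x) = E_x[H(X(1))] − H(x) = −μ³(2−μ)v² + 2ζμ(1−μ)v − 2ζμu + 2(ζ² + σ²). -/
open MeasureTheory ProbabilityTheory Filter

noncomputable section

/-- The Lyapunov function `H(r,z) = (r + λz)² + (r + (λ+μ)z)²`. -/
def lyapH (lam mu : ℝ) (p : ℝ × ℝ) : ℝ :=
  (p.1 + lam * p.2) ^ 2 + (p.1 + (lam + mu) * p.2) ^ 2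

/-- The one-step drift of `H`: `𝒟H(x) = E_x[H(X(1))] − H(x)`. -/
def driftH (lam mu zeta xi rstar sigma : ℝ) (x : ℝ × ℝ) : ℝ :=
  (∫ n, lyapH lam mu (step lam mu zeta xi rstar x n) ∂(noise sigma)) - lyapH lam mu x

end

/-- The second moment of a shifted centred Gaussian: `E[(a + N)²] = a² + v`. -/
theorem hasSecondMoment_add_gaussianReal (a : ℝ) (v : NNReal) :
    Integrable (fun n => (a + n) ^ 2) (gaussianReal 0 v) ∧
      ∫ n, (a + n) ^ 2 ∂(gaussianReal 0 v) = a ^ 2 + v := by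
  have hLp : MemLp (fun n : ℝ => a + n) 2 (gaussianReal 0 v) :=
    (memLp_const a).add (memLp_id_gaussianReal 2)
  have hid : Integrable (fun n : ℝ => n) (gaussianReal 0 v) :=
    (memLp_id_gaussianReal 2).integrable (by norm_num)
  refine ⟨hLp.integrable_sq, ?_⟩
  have hmean : ∫ n, (a + n) ∂(gaussianReal 0 v) = a := by
    rw [integral_add (integrable_const a) hid, integral_id_gaussianReal]
    simp
  have hvar : variance (fun n : ℝ => a + n) (gaussianReal 0 v) = v := by
    rw [variance_const_add hid.aestronglyMeasurable, variance_fun_id_gaussianReal]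
  have h := variance_eq_sub hLp
  simp only [hvar, hmean, Pi.pow_apply] at h
  linarith

/-- For `r < 0` the two linear forms squared in `lyapH` evolve affinely. -/
theorem lyapH_step_of_neg {lam mu zeta xi rstar r : ℝ} (hzeta : 0 < zeta) (hxi : 0 < xi)
    (hrstar : zeta < rstar) (hr : r < 0) (z n : ℝ) :
    lyapH lam mu (step lam mu zeta xi rstar (r, z) n)
      = (r + lam * z + zeta + n) ^ 2
        + ((1 - mu) * (r + (lam + mu) * z) + zeta + n) ^ 2 := by
  simp only [lyapH, step]
  rw [max_eq_left (by linarith : (0 : ℝ) ≤ -r),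
    min_eq_left (by linarith : zeta ≤ rstar - r), max_eq_left (by linarith : -xi ≤ zeta)]
  ring

/-- Exact drift identity of the Lyapunov function `H` in domain `D1`
(`r < 0`), expressed in the coordinates `u = −(r+λz)/μ`, `v = (r+(λ+μ)z)/μ`:
`𝒟H(x) = −μ³(2−μ)v² + 2ζμ(1−μ)v − 2ζμu + 2(ζ² + σ²)`. -/
theorem drift_identity_D1
    (lam mu zeta xi rstar sigma : ℝ)
    (hlam : 0 < lam) (hzeta : 0 < zeta) (hxi : 0 < xi) (hrstar : zeta < rstar)
    (hsigma : 0 < sigma) (hmu : mu ≠ 0)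
    (r z : ℝ) (hr : r < 0) (hz : 0 ≤ z) :
    driftH lam mu zeta xi rstar sigma (r, z)
      = -mu ^ 3 * (2 - mu) * ((r + (lam + mu) * z) / mu) ^ 2
        + 2 * zeta * mu * (1 - mu) * ((r + (lam + mu) * z) / mu)
        - 2 * zeta * mu * (-(r + lam * z) / mu)
        + 2 * (zeta ^ 2 + sigma ^ 2) := by
  have hv : ((sigma ^ 2).toNNReal : ℝ) = sigma ^ 2 := Real.coe_toNNReal _ (sq_nonneg sigma)
  obtain ⟨hi₁, he₁⟩ := hasSecondMoment_add_gaussianReal (r + lam * z + zeta) (sigma ^ 2).toNNReal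
  obtain ⟨hi₂, he₂⟩ := hasSecondMoment_add_gaussianReal
    ((1 - mu) * (r + (lam + mu) * z) + zeta) (sigma ^ 2).toNNReal
  simp only [driftH, lyapH_step_of_neg hzeta hxi hrstar hr, noise]
  rw [integral_add hi₁ hi₂, he₁, he₂, hv, lyapH]
  field_simp
  ring
end

section
/- Suppose μ > 0 and λ + μ < 1, and let x = (r,z) ∈ D2. With u = r + λz and v = z (so that λv ≤ u < λv + r* − ζ), the one-step drift of H satisfies 𝒟H(x) = E_x[H(X(1))] − H(x) ≤ 2σ² − 2ζ² + 4ζr* + 2ζ[2λ + μ(1−λ−μ)]v − μ(λ+μ)²(2−μ)v². -/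
open MeasureTheory ProbabilityTheory Filter

/-- The mean of `(a + n)² + (b + n)²` under centred Gaussian noise `n` of variance `σ²`. -/
theorem integral_add_sq_add_add_sq_noise (sigma a b : ℝ) :
    ∫ n, ((a + n) ^ 2 + (b + n) ^ 2) ∂(noise sigma) = a ^ 2 + b ^ 2 + 2 * sigma ^ 2 := by
  unfold noise
  set w := (sigma ^ 2).toNNReal with hw
  have h_int : Integrable (fun n : ℝ => n) (gaussianReal 0 w) :=
    (memLp_id_gaussianReal (μ := 0) (v := w) 1).integrable le_rfl
  have h_int_sq : Integrable (fun n : ℝ => n ^ 2) (gaussianReal 0 w) :=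
    (memLp_id_gaussianReal (μ := 0) (v := w) 2).integrable_sq
  have h_mean : ∫ n, n ∂(gaussianReal 0 w) = 0 := integral_id_gaussianReal
  have h_sq : ∫ n, n ^ 2 ∂(gaussianReal 0 w) = sigma ^ 2 := by
    have h_var := variance_fun_id_gaussianReal (μ := 0) (v := w)
    rw [variance_of_integral_eq_zero aemeasurable_id' h_mean] at h_var
    rw [h_var, hw, Real.coe_toNNReal _ (sq_nonneg sigma)]
  have h_expand : ∀ n : ℝ, (a + n) ^ 2 + (b + n) ^ 2
      = 2 * (a + b) * n + 2 * n ^ 2 + (a ^ 2 + b ^ 2) := fun n => by ring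
  simp_rw [h_expand]
  have h_sum : Integrable (fun n : ℝ => 2 * (a + b) * n + 2 * n ^ 2) (gaussianReal 0 w) :=
    (h_int.const_mul _).add (h_int_sq.const_mul _)
  rw [integral_add h_sum (integrable_const _),
    integral_add (h_int.const_mul _) (h_int_sq.const_mul _), integral_const_mul,
    integral_const_mul, h_mean, h_sq, integral_const, probReal_univ, one_smul]
  ring

/-- The exact drift of `H` on `D2`. -/
theorem driftH_eq_of_nonneg_of_lt {lam mu zeta xi rstar sigma r z : ℝ}
    (hzeta : 0 < zeta) (hxi : 0 < xi) (hr0 : 0 ≤ r) (hr1 : r < rstar - zeta) :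
    driftH lam mu zeta xi rstar sigma (r, z)
      = (r + lam * z + zeta) ^ 2 + (r + lam * z + mu * (1 - lam - mu) * z + zeta) ^ 2
        + 2 * sigma ^ 2 - ((r + lam * z) ^ 2 + (r + (lam + mu) * z) ^ 2) := by
  have h_step : ∀ n, lyapH lam mu (step lam mu zeta xi rstar (r, z) n)
      = (r + lam * z + zeta + n) ^ 2
        + (r + lam * z + mu * (1 - lam - mu) * z + zeta + n) ^ 2 := fun n => by
    simp only [lyapH, step]
    rw [max_eq_right (neg_nonpos.mpr hr0), min_eq_left (by linarith), max_eq_left (by linarith)]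
    ring
  simp only [driftH, h_step, integral_add_sq_add_add_sq_noise]
  rfl

/-- Drift bound of the Lyapunov function `H` in domain `D2`
(`0 ≤ r < r* − ζ`), with `v = z`:
`𝒟H(x) ≤ 2σ² − 2ζ² + 4ζr* + 2ζ[2λ + μ(1−λ−μ)]v − μ(λ+μ)²(2−μ)v²`. -/
theorem drift_bound_D2
    (lam mu zeta xi rstar sigma : ℝ)
    (hlam : 0 < lam) (hzeta : 0 < zeta) (hxi : 0 < xi) (hrstar : zeta < rstar)
    (hsigma : 0 < sigma) (hmu : 0 < mu) (hlm : lam + mu < 1)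
    (r z : ℝ) (hr0 : 0 ≤ r) (hr1 : r < rstar - zeta) (hz : 0 ≤ z) :
    driftH lam mu zeta xi rstar sigma (r, z)
      ≤ 2 * sigma ^ 2 - 2 * zeta ^ 2 + 4 * zeta * rstar
        + 2 * zeta * (2 * lam + mu * (1 - lam - mu)) * z
        - mu * (lam + mu) ^ 2 * (2 - mu) * z ^ 2 := by
  rw [driftH_eq_of_nonneg_of_lt hzeta hxi hr0 hr1]
  have h_linear : 0 ≤ zeta * (rstar - zeta - r) :=
    mul_nonneg hzeta.le (sub_nonneg.mpr hr1.le)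
  have h_cross : 0 ≤ r * mu * (lam + mu) * z := by positivity
  linear_combination 4 * h_linear + 2 * h_cross
end

section
/- Suppose μ > 0 and λ + μ < 1, and let x = (r,z) ∈ D4. With u = r + λz and v = z (so that u ≥ λv + r* + ξ), the one-step drift of H satisfies 𝒟H(x) = E_x[H(X(1))] − H(x) ≤ 2σ² + 2ξ² − 4ξu − (2μ(λ+μ)r* + 2ξμ)v − μ(λ+μ)²(2−μ)v². -/
open MeasureTheory ProbabilityTheory Filter

/-- The second moment of `c + N` for centred Gaussian noise `N ~ N(0, σ²)`. -/
lemma integral_const_add_sq_noise (sigma c : ℝ) :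
    ∫ n, (c + n) ^ 2 ∂(noise sigma) = c ^ 2 + sigma ^ 2 := by
  have hvar : ∫ n, (n - 0) ^ 2 ∂(noise sigma) = sigma ^ 2 := by
    have h := variance_fun_id_gaussianReal (μ := 0) (v := (sigma ^ 2).toNNReal)
    rw [variance_eq_integral measurable_id'.aemeasurable, integral_id_gaussianReal,
      Real.coe_toNNReal _ (sq_nonneg sigma)] at h
    exact h
  have hmean : ∫ n, n ∂(noise sigma) = 0 := integral_id_gaussianReal
  have : IsProbabilityMeasure (noise sigma) := by unfold noise; infer_instance
  have hid : Integrable (fun n : ℝ => n) (noise sigma) :=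
    (memLp_id_gaussianReal 1).integrable le_rfl
  have hsq : Integrable (fun n : ℝ => n ^ 2) (noise sigma) :=
    (memLp_id_gaussianReal 2).integrable_sq
  have hlin : Integrable (fun n : ℝ => 2 * c * n) (noise sigma) := hid.const_mul _
  have hconst_add_lin : Integrable (fun n : ℝ => c ^ 2 + 2 * c * n) (noise sigma) :=
    (integrable_const _).add hlin
  simp only [sub_zero] at hvar
  simp_rw [add_sq]
  rw [integral_add hconst_add_lin hsq,
    integral_add (integrable_const _) hlin, integral_const_mul, hmean, hvar]
  simp

lemma integrable_const_add_sq_noise (sigma c : ℝ) :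
    Integrable (fun n : ℝ => (c + n) ^ 2) (noise sigma) :=
  ((memLp_const c).add (memLp_id_gaussianReal 2)).integrable_sq

/-- In `D4` the next state makes `H` a sum of two squares of shifted noise. -/
lemma lyapH_step_D4 (lam mu : ℝ) {zeta xi rstar r : ℝ} (z n : ℝ) (hzeta : 0 < zeta)
    (hxi : 0 < xi) (hr : rstar + xi ≤ r) (hr0 : 0 ≤ r) :
    lyapH lam mu (step lam mu zeta xi rstar (r, z) n)
      = (r + lam * z - xi + n) ^ 2
        + (r + lam * z - xi + mu * (1 - lam - mu) * z + n) ^ 2 := by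
  have h1 : max (-r) 0 = 0 := max_eq_right (by linarith)
  have h2 : max (min zeta (rstar - r)) (-xi) = -xi := by
    rw [min_eq_right (by linarith), max_eq_right (by linarith)]
  simp only [lyapH, step, h1, h2]
  ring

/-- Drift bound of the Lyapunov function `H` in domain `D4`
(`r ≥ r* + ξ`), with `u = r + λz`, `v = z`:
`𝒟H(x) ≤ 2σ² + 2ξ² − 4ξu − (2μ(λ+μ)r* + 2ξμ)v − μ(λ+μ)²(2−μ)v²`. -/
theorem drift_bound_D4
    (lam mu zeta xi rstar sigma : ℝ)
    (hlam : 0 < lam) (hzeta : 0 < zeta) (hxi : 0 < xi) (hrstar : zeta < rstar)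
    (hsigma : 0 < sigma) (hmu : 0 < mu) (hlm : lam + mu < 1)
    (r z : ℝ) (hr : rstar + xi ≤ r) (hz : 0 ≤ z) :
    driftH lam mu zeta xi rstar sigma (r, z)
      ≤ 2 * sigma ^ 2 + 2 * xi ^ 2 - 4 * xi * (r + lam * z)
        - (2 * mu * (lam + mu) * rstar + 2 * xi * mu) * z
        - mu * (lam + mu) ^ 2 * (2 - mu) * z ^ 2 := by
  have hstep := fun n => lyapH_step_D4 lam mu z n hzeta hxi hr (by linarith)
  have hs : 0 ≤ 2 * mu * (lam + mu) * z := by positivity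
  have hgap := mul_nonneg hs (sub_nonneg.mpr hr)
  unfold driftH
  simp_rw [hstep]
  rw [integral_add (integrable_const_add_sq_noise _ _) (integrable_const_add_sq_noise _ _),
    integral_const_add_sq_noise, integral_const_add_sq_noise]
  simp only [lyapH]
  linarith
end

section
/- Suppose μ > 0 and λ + μ < 1. Then there exist a > 0 and b > 0 such that for every x = (r,z) ∈ S with x ∉ [−a, a] × [0, b], the one-step drift of the Lyapunov function satisfies 𝒟H(x) = E_x[H(X(1))] − H(x) ≤ −1. Equivalently, there exist a compact set C ⊂ S and a constant c > 0 with 𝒟H(x) ≤ −1 + c·1_C(x) for all x ∈ S. -/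
open MeasureTheory ProbabilityTheory Filter

lemma integral_sum_sq_add_noise (A B sigma : ℝ) :
    ∫ n, ((A + n) ^ 2 + (B + n) ^ 2) ∂(noise sigma) = A ^ 2 + B ^ 2 + 2 * sigma ^ 2 := by
  unfold noise
  set ν := gaussianReal 0 (sigma ^ 2).toNNReal with hν
  have h1 : Integrable (fun n : ℝ => n) ν :=
    (memLp_id_gaussianReal' 1 (by simp)).integrable le_rfl
  have h2 : Integrable (fun n : ℝ => n ^ 2) ν :=
    (memLp_id_gaussianReal' 2 (by simp)).integrable_sq
  have hmean : ∫ n, n ∂ν = 0 := integral_id_gaussianReal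
  have hvar : ∫ n, n ^ 2 ∂ν = sigma ^ 2 := by
    have h := variance_fun_id_gaussianReal (μ := 0) (v := (sigma ^ 2).toNNReal)
    rw [← hν, variance_eq_integral (by fun_prop), hmean,
      Real.coe_toNNReal _ (sq_nonneg sigma)] at h
    simpa using h
  have hexp : (fun n : ℝ => (A + n) ^ 2 + (B + n) ^ 2)
      = fun n => (A ^ 2 + B ^ 2) + ((2 * (A + B)) * n + 2 * n ^ 2) := by
    funext n; ring
  have hlin : Integrable (fun n : ℝ => (2 * (A + B)) * n + 2 * n ^ 2) ν :=
    (h1.const_mul _).add (h2.const_mul _)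
  rw [hexp, integral_add (integrable_const _) hlin,
    integral_add (h1.const_mul _) (h2.const_mul _), integral_const_mul, integral_const_mul,
    hmean, hvar]
  simp

/-- In the coordinates `u = r + λz` and `v = r + (λ+μ)z`, one step adds the clipped control to `u`
and to `v - μ(v - r⁺)`. -/
lemma driftH_eq (lam mu zeta xi rstar sigma r z : ℝ) :
    driftH lam mu zeta xi rstar sigma (r, z) =
      (r + lam * z + max (min zeta (rstar - r)) (-xi)) ^ 2
        + (r + (lam + mu) * z - mu * ((lam + mu) * z - max (-r) 0)
            + max (min zeta (rstar - r)) (-xi)) ^ 2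
        + 2 * sigma ^ 2 - ((r + lam * z) ^ 2 + (r + (lam + mu) * z) ^ 2) := by
  unfold driftH
  rw [← integral_sum_sq_add_noise]
  simp only [lyapH, step]
  congr 2
  funext n
  ring

lemma neg_sq_add_le {A : ℝ} (hA : 0 < A) (B y : ℝ) : -(A * y ^ 2) + B * y ≤ B ^ 2 / (4 * A) := by
  rw [le_div_iff₀ (by positivity)]
  nlinarith [sq_nonneg (2 * A * y - B)]

lemma exists_driftH_le_of_nonneg {lam mu zeta xi rstar : ℝ} (sigma : ℝ)
    (hlam : 0 < lam) (hzeta : 0 < zeta) (hxi : 0 < xi) (hrstar : zeta < rstar)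
    (hmu : 0 < mu) (hlm : lam + mu < 1) :
    ∃ K : ℝ, ∀ r z : ℝ, 0 ≤ r → 0 ≤ z →
      driftH lam mu zeta xi rstar sigma (r, z) ≤ K - (4 * xi * r + z) := by
  refine ⟨4 * (zeta + xi) * (rstar + xi) + 4 * xi * (rstar + xi)
    + (4 * (zeta + xi) + 1) ^ 2 / (4 * (mu * (lam + mu) ^ 2))
    + 2 * (zeta + xi) ^ 2 + 2 * sigma ^ 2, fun r z hr hz => ?_⟩
  rw [driftH_eq, max_eq_right (by linarith : -r ≤ 0)]
  set g := max (min zeta (rstar - r)) (-xi) with hg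
  have hg_le : g ≤ zeta := max_le (min_le_left _ _) (by linarith)
  have hg_ge : -xi ≤ g := le_max_right _ _
  have hgr : g * r ≤ (zeta + xi) * (rstar + xi) + xi * (rstar + xi) - xi * r := by
    have hM : 0 ≤ (zeta + xi) * (rstar + xi) := by
      apply mul_nonneg <;> linarith
    have hx : 0 ≤ xi * (rstar + xi) := by
      apply mul_nonneg <;> linarith
    rcases le_total (rstar + xi) r with h | h
    · have : g = -xi := max_eq_right ((min_le_right _ _).trans (by linarith))
      rw [this]; linarith
    · nlinarith [mul_le_mul_of_nonneg_left h hxi.le]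
  have hgsq : g ^ 2 ≤ (zeta + xi) ^ 2 := sq_le_sq' (by linarith) (by linarith)
  set q := lam + mu with hq
  have hq0 : 0 < q := by positivity
  have hquad := neg_sq_add_le (by positivity : 0 < mu * q ^ 2) (4 * (zeta + xi) + 1) z
  have hcoef0 : 0 ≤ lam + q - mu * q := by nlinarith
  have hcoef2 : lam + q - mu * q ≤ 2 := by nlinarith [mul_pos hmu hq0]
  have hgz : g * ((lam + q - mu * q) * z) ≤ (zeta + xi) * (2 * z) := by
    calc g * ((lam + q - mu * q) * z) ≤ (zeta + xi) * ((lam + q - mu * q) * z) := by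
          apply mul_le_mul_of_nonneg_right (by linarith) (by positivity)
      _ ≤ (zeta + xi) * (2 * z) := by gcongr
  have hcross : 0 ≤ mu * q * (r * z) := by positivity
  have hmusq : mu ^ 2 * (q ^ 2 * z ^ 2) ≤ mu * (q ^ 2 * z ^ 2) := by
    apply mul_le_mul_of_nonneg_right _ (by positivity)
    nlinarith
  linear_combination 4 * hgr + 2 * hgz + hquad + 2 * hgsq + 2 * hcross + hmusq

lemma exists_driftH_le_of_neg {lam mu zeta xi rstar : ℝ} (sigma : ℝ)
    (hzeta : 0 < zeta) (hxi : 0 < xi) (hrstar : zeta < rstar)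
    (hmu : 0 < mu) (hmu1 : mu < 1) (hlm : lam + mu < 1) :
    ∃ K : ℝ, ∀ r z : ℝ, r < 0 → 0 ≤ z →
      driftH lam mu zeta xi rstar sigma (r, z) ≤ K - zeta * mu * (-r + z) := by
  refine ⟨(zeta * (4 - 3 * mu)) ^ 2 / (4 * mu) + 2 * zeta ^ 2 + 2 * sigma ^ 2,
    fun r z hr hz => ?_⟩
  rw [driftH_eq, max_eq_left (by linarith : 0 ≤ -r), min_eq_left (by linarith : zeta ≤ rstar - r),
    max_eq_left (by linarith : -xi ≤ zeta)]
  have hquad := neg_sq_add_le hmu (zeta * (4 - 3 * mu)) (r + (lam + mu) * z)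
  have hqz : zeta * mu * ((lam + mu) * z) ≤ zeta * mu * z :=
    mul_le_mul_of_nonneg_left (by nlinarith) (by positivity)
  have hmusq : mu ^ 2 * (r + (lam + mu) * z) ^ 2 ≤ mu * (r + (lam + mu) * z) ^ 2 := by
    apply mul_le_mul_of_nonneg_right _ (by positivity)
    nlinarith
  linear_combination hquad + hqz + hmusq

lemma exists_driftH_le_sub_abs {lam mu zeta xi rstar : ℝ} (sigma : ℝ)
    (hlam : 0 < lam) (hzeta : 0 < zeta) (hxi : 0 < xi) (hrstar : zeta < rstar)
    (hmu : 0 < mu) (hlm : lam + mu < 1) :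
    ∃ K c : ℝ, 0 < K ∧ 0 < c ∧ ∀ r z : ℝ, 0 ≤ z →
      driftH lam mu zeta xi rstar sigma (r, z) ≤ K - c * (|r| + z) := by
  obtain ⟨K₁, h₁⟩ := exists_driftH_le_of_nonneg sigma hlam hzeta hxi hrstar hmu hlm
  obtain ⟨K₂, h₂⟩ := exists_driftH_le_of_neg sigma hzeta hxi hrstar hmu (by linarith) hlm
  refine ⟨max (max K₁ K₂) 1, min (min (4 * xi) 1) (zeta * mu),
    lt_max_of_lt_right one_pos, by positivity, fun r z hz => ?_⟩
  set c := min (min (4 * xi) 1) (zeta * mu)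
  have hc₁ : c ≤ 4 * xi := (min_le_left _ _).trans (min_le_left _ _)
  have hc₂ : c ≤ 1 := (min_le_left _ _).trans (min_le_right _ _)
  have hc₃ : c ≤ zeta * mu := min_le_right _ _
  have hK₁ : K₁ ≤ max (max K₁ K₂) 1 := (le_max_left _ _).trans (le_max_left _ _)
  have hK₂ : K₂ ≤ max (max K₁ K₂) 1 := (le_max_right _ _).trans (le_max_left _ _)
  rcases le_or_gt 0 r with hr | hr
  · rw [abs_of_nonneg hr]
    linarith [h₁ r z hr hz, mul_le_mul_of_nonneg_right hc₁ hr, mul_le_mul_of_nonneg_right hc₂ hz]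
  · rw [abs_of_neg hr]
    linarith [h₂ r z hr hz, mul_le_mul_of_nonneg_right hc₃ (by linarith : 0 ≤ -r + z)]

/-- For `μ > 0`, `λ + μ < 1`, the drift of the Lyapunov function `H` is at
most `−1` outside a rectangle `[−a,a] × [0,b]`; equivalently `𝒟H(x) ≤ −1 + c·1_C(x)` on `S`
for a compact set `C ⊆ S` and a constant `c > 0`. -/
theorem drift_negative_outside_compact
    (lam mu zeta xi rstar sigma : ℝ)
    (hlam : 0 < lam) (hzeta : 0 < zeta) (hxi : 0 < xi) (hrstar : zeta < rstar)
    (hsigma : 0 < sigma) (hmu : 0 < mu) (hlm : lam + mu < 1) :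
    (∃ a b : ℝ, 0 < a ∧ 0 < b ∧
      ∀ x : ℝ × ℝ, 0 ≤ x.2 → x ∉ Set.Icc (-a) a ×ˢ Set.Icc (0 : ℝ) b →
        driftH lam mu zeta xi rstar sigma x ≤ -1) ∧
    (∃ C : Set (ℝ × ℝ), IsCompact C ∧ C ⊆ {p | 0 ≤ p.2} ∧
      ∃ c : ℝ, 0 < c ∧
        ∀ x : ℝ × ℝ, 0 ≤ x.2 →
          driftH lam mu zeta xi rstar sigma x ≤ -1 + c * C.indicator (fun _ => (1 : ℝ)) x) := by
  obtain ⟨K, c, hK, hc, hdrift⟩ :=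
    exists_driftH_le_sub_abs sigma hlam hzeta hxi hrstar hmu hlm
  have hb : 0 < (K + 1) / c := by positivity
  have hout : ∀ x : ℝ × ℝ, 0 ≤ x.2 →
      x ∉ Set.Icc (-((K + 1) / c)) ((K + 1) / c) ×ˢ Set.Icc (0 : ℝ) ((K + 1) / c) →
      driftH lam mu zeta xi rstar sigma x ≤ -1 := by
    rintro ⟨r, z⟩ hz hx
    have hlarge : (K + 1) / c ≤ |r| + z := by
      by_contra! hlt
      refine hx ⟨abs_le.mp ?_, hz, ?_⟩
      · linarith [show 0 ≤ z from hz]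
      · linarith [abs_nonneg r]
    rw [div_le_iff₀' hc] at hlarge
    linarith [hdrift r z hz]
  refine ⟨⟨_, _, hb, hb, hout⟩,
    Set.Icc (-((K + 1) / c)) ((K + 1) / c) ×ˢ Set.Icc (0 : ℝ) ((K + 1) / c),
    isCompact_Icc.prod isCompact_Icc, fun p hp => hp.2.1, K + 1, by positivity, fun x hz => ?_⟩
  by_cases hx : x ∈ Set.Icc (-((K + 1) / c)) ((K + 1) / c) ×ˢ Set.Icc (0 : ℝ) ((K + 1) / c)
  · rw [Set.indicator_of_mem hx]
    have h := hdrift x.1 x.2 hz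
    have : 0 ≤ c * (|x.1| + x.2) := by positivity
    linarith
  · rw [Set.indicator_of_notMem hx]
    linarith [hout x hz hx]
end

section
/- Suppose −λ < μ < 0. Define G : S → [0,∞) by G(r,z) = log((r + (λ+μ)z)/μ) if (r + (λ+μ)z)/μ ≥ 1 and G(r,z) = 0 otherwise. Then G has uniformly bounded expected increments along the chain: sup over x ∈ S of E_x|G(X(1)) − G(x)| is finite. -/
open MeasureTheory ProbabilityTheory Filter

noncomputable section

/-- The function `G(r,z) = log((r + (λ+μ)z)/μ)` when `v(r,z) = (r + (λ+μ)z)/μ ≥ 1`,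
and `G(r,z) = 0` otherwise. -/
def funG (lam mu : ℝ) (p : ℝ × ℝ) : ℝ :=
  if 1 ≤ (p.1 + (lam + mu) * p.2) / mu then
    Real.log ((p.1 + (lam + mu) * p.2) / mu)
  else 0

end

theorem log_max_one_sub_le (a b : ℝ) :
    Real.log (max 1 a) - Real.log (max 1 b) ≤ |a - b| := by
  have hA : 0 < max 1 a := lt_max_of_lt_left one_pos
  have hB : 1 ≤ max 1 b := le_max_left 1 b
  have hB' : 0 < max 1 b := one_pos.trans_le hB
  rw [← Real.log_div hA.ne' hB'.ne']
  refine (Real.log_le_sub_one_of_pos (div_pos hA hB')).trans ?_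
  rw [div_sub_one hB'.ne', div_le_iff₀ hB']
  have h : max 1 a - max 1 b ≤ |a - b| :=
    (le_abs_self _).trans (by simpa using abs_max_sub_max_le_max 1 a 1 b)
  exact h.trans (le_mul_of_one_le_right (abs_nonneg _) hB)

theorem abs_log_max_one_sub_le (a b : ℝ) :
    |Real.log (max 1 a) - Real.log (max 1 b)| ≤ |a - b| :=
  abs_le.2 ⟨by linarith [log_max_one_sub_le b a, abs_sub_comm a b], log_max_one_sub_le a b⟩

theorem abs_log_max_one_mul_sub_le {c : ℝ} (hc : 1 ≤ c) (v : ℝ) :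
    |Real.log (max 1 (c * v)) - Real.log (max 1 v)| ≤ c - 1 := by
  have hc0 : 0 < c := one_pos.trans_le hc
  have hlow : max 1 v ≤ max 1 (c * v) := by
    rcases le_total v 1 with h | h
    · simp [h]
    · exact max_le_max le_rfl (le_mul_of_one_le_left (by linarith) hc)
  have hup : max 1 (c * v) ≤ c * max 1 v :=
    max_le (by nlinarith [le_max_left 1 v])
      (mul_le_mul_of_nonneg_left (le_max_right 1 v) hc0.le)
  have hv : 0 < max 1 v := lt_max_of_lt_left one_pos
  have h1 := Real.log_le_log hv hlow
  have h2 := Real.log_le_log (hv.trans_le hlow) hup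
  rw [Real.log_mul hc0.ne' hv.ne'] at h2
  rw [abs_of_nonneg (by linarith)]
  linarith [Real.log_le_sub_one_of_pos hc0]

theorem funG_eq_log_max (lam mu : ℝ) (p : ℝ × ℝ) :
    funG lam mu p = Real.log (max 1 ((p.1 + (lam + mu) * p.2) / mu)) := by
  unfold funG
  split_ifs with h
  · rw [max_eq_right h]
  · rw [max_eq_left (not_le.1 h).le, Real.log_one]

theorem abs_funG_step_sub_le {lam mu zeta xi rstar : ℝ} (hzeta : 0 < zeta) (hxi : 0 < xi)
    (hmu1 : -lam < mu) (hmu2 : mu < 0) {x : ℝ × ℝ} (hx : 0 ≤ x.2) (n : ℝ) :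
    |funG lam mu (step lam mu zeta xi rstar x n) - funG lam mu x|
      ≤ -mu + (zeta + xi + |n|) / -mu := by
  obtain ⟨r, z⟩ := x
  dsimp only at hx
  rw [funG_eq_log_max, funG_eq_log_max]
  simp only [step]
  set c := max (min zeta (rstar - r)) (-xi)
  have hc1 : -xi ≤ c := le_max_right _ _
  have hc2 : c ≤ zeta := max_le (min_le_left _ _) (by linarith)
  have hw : |(c + n) / mu| ≤ (zeta + xi + |n|) / -mu := by
    rw [abs_div, abs_of_neg hmu2]
    refine div_le_div_of_nonneg_right ((abs_add_le c n).trans ?_) (by linarith)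
    have hcabs : |c| ≤ zeta + xi := abs_le.2 ⟨by linarith, by linarith⟩
    linarith
  rcases le_total r 0 with hr | hr
  · rw [max_eq_left (by linarith : 0 ≤ -r)]
    set v := (r + (lam + mu) * z) / mu with hv
    have hstep : (r - lam * -r + lam * (lam + mu) * z + c + n
        + (lam + mu) * (-r + (1 - lam - mu) * z)) / mu = (1 - mu) * v + (c + n) / mu := by
      rw [hv]; field_simp; ring
    rw [hstep]
    have h1 := abs_log_max_one_sub_le ((1 - mu) * v + (c + n) / mu) ((1 - mu) * v)
    have h2 := abs_log_max_one_mul_sub_le (by linarith : 1 ≤ 1 - mu) v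
    rw [add_sub_cancel_left] at h1
    have h3 := abs_sub_le (Real.log (max 1 ((1 - mu) * v + (c + n) / mu)))
      (Real.log (max 1 ((1 - mu) * v))) (Real.log (max 1 v))
    linarith
  · rw [max_eq_right (by linarith : -r ≤ 0)]
    have ha : 0 < lam + mu := by linarith
    have hv : (r + (lam + mu) * z) / mu ≤ 0 :=
      div_nonpos_of_nonneg_of_nonpos (by positivity) hmu2.le
    have hle : (r - lam * 0 + lam * (lam + mu) * z + c + n
        + (lam + mu) * (0 + (1 - lam - mu) * z)) / mu ≤ (c + n) / mu := by
      refine div_le_div_of_nonpos_of_le hmu2.le ?_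
      have : 0 ≤ (lam + mu) * z * (1 - mu) := mul_nonneg (by positivity) (by linarith)
      linarith
    have h1 := Real.log_le_log (lt_max_of_lt_left one_pos) (max_le_max (le_refl (1 : ℝ)) hle)
    have h2 := log_max_one_sub_le ((c + n) / mu) 0
    rw [max_eq_left (hv.trans zero_le_one), Real.log_one, sub_zero,
      abs_of_nonneg (Real.log_nonneg (le_max_left _ _))]
    rw [max_eq_left zero_le_one, Real.log_one, sub_zero, sub_zero] at h2
    linarith

/-- For `−λ < μ < 0`, the function `G` has uniformly bounded expected
increments along the chain: `sup_{x ∈ S} E_x|G(X(1)) − G(x)| < ∞`. -/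
theorem bounded_increments_of_G
    (lam mu zeta xi rstar sigma : ℝ)
    (hlam : 0 < lam) (hzeta : 0 < zeta) (hxi : 0 < xi) (hrstar : zeta < rstar)
    (hsigma : 0 < sigma) (hmu1 : -lam < mu) (hmu2 : mu < 0) :
    ∃ M : ℝ, ∀ x : ℝ × ℝ, 0 ≤ x.2 →
      (∫ n, |funG lam mu (step lam mu zeta xi rstar x n) - funG lam mu x| ∂(noise sigma))
        ≤ M := by
  have hint : Integrable (fun n : ℝ => -mu + (zeta + xi + |n|) / -mu) (noise sigma) := by
    have hid : Integrable (fun n : ℝ => n) (noise sigma) :=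
      (memLp_id_gaussianReal 1).integrable le_rfl
    have : IsProbabilityMeasure (noise sigma) := by unfold noise; infer_instance
    exact (integrable_const _).add (((integrable_const _).add hid.abs).div_const _)
  exact ⟨_, fun x hx => integral_mono_of_nonneg (Eventually.of_forall fun _ => abs_nonneg _) hint
    (Eventually.of_forall fun n => abs_funG_step_sub_le hzeta hxi hmu1 hmu2 hx n)⟩
end

section
/- Fix an integer τ ≥ 2 and real constants ε > 0 (coefficient of performance), K > 0 (leakiness), C (thermal inertia). Let θ, T*, T, D^a, F be real sequences and define Z(τ−1) = Σ_{t=1}^{τ−1} F(t), and let Z(τ) be a real number. Assume: (i) D^a(t)·ε = K(T*(t) − θ(t)) + C(T*(t) − T*(t−1)) for t = 1,…,τ; (ii) (D^a(t) − F(t))·ε = K(T(t) − θ(t)) + C(T(t) − T(t−1)) for t = 1,…,τ−1; (iii) (D^a(τ) + Z(τ))·ε = K(T*(τ) − θ(τ)) + C(T*(τ) − T(τ−1)); (iv) T(0) = T*(0). Then Z(τ) − Z(τ−1) = −(K/ε)·Σ_{t=1}^{τ−1}(T*(t) − T(t)). Moreover, if in addition T(t) < T*(t) for all t = 1,…,τ−1,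 then Z(τ) − Z(τ−1) < 0. -/
/-- Summing `F t * ε = K * d t + C * (d t - d (t - 1))` telescopes the inertia term. -/
theorem sum_mul_eq_of_leak_inertia (ε K C : ℝ) (d F : ℕ → ℝ) (h0 : d 0 = 0) (n : ℕ)
    (h : ∀ t ∈ Finset.Icc 1 n, F t * ε = K * d t + C * (d t - d (t - 1))) :
    (∑ t ∈ Finset.Icc 1 n, F t) * ε = K * ∑ t ∈ Finset.Icc 1 n, d t + C * d n := by
  induction n with
  | zero => simp [h0]
  | succ n ih =>
    have hsum := ih fun t ht => h t (Finset.Icc_subset_Icc_right n.le_succ ht)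
    have hlast := h (n + 1) (by simp)
    rw [Nat.add_sub_cancel] at hlast
    rw [Finset.sum_Icc_succ_top (by omega), Finset.sum_Icc_succ_top (by omega)]
    linarith

/-- Appendix A.1, heating with constant coefficient of performance.
Under the two-scenario heating model with constant coefficient of performance `ε`,
the backlogged demand satisfies
`Z(τ) − Z(τ−1) = −(K/ε)·Σ_{t=1}^{τ−1}(T*(t) − T(t))`,
where `Z(τ−1) = Σ_{t=1}^{τ−1} F(t)`; in particular it is negative (positive evaporation)
if `T(t) < T*(t)` for `t = 1,…,τ−1`. -/
theorem heating_positive_evaporation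
    (τ : ℕ) (hτ : 2 ≤ τ) (ε K C : ℝ) (hε : 0 < ε) (hK : 0 < K)
    (θ Tstar T Da F : ℕ → ℝ) (Zτ : ℝ)
    (h1 : ∀ t ∈ Finset.Icc 1 τ,
      Da t * ε = K * (Tstar t - θ t) + C * (Tstar t - Tstar (t - 1)))
    (h2 : ∀ t ∈ Finset.Icc 1 (τ - 1),
      (Da t - F t) * ε = K * (T t - θ t) + C * (T t - T (t - 1)))
    (h3 : (Da τ + Zτ) * ε = K * (Tstar τ - θ τ) + C * (Tstar τ - T (τ - 1)))
    (h4 : T 0 = Tstar 0) :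
    Zτ - (∑ t ∈ Finset.Icc 1 (τ - 1), F t)
        = -(K / ε) * ∑ t ∈ Finset.Icc 1 (τ - 1), (Tstar t - T t) ∧
    ((∀ t ∈ Finset.Icc 1 (τ - 1), T t < Tstar t) →
      Zτ - (∑ t ∈ Finset.Icc 1 (τ - 1), F t) < 0) := by
  have hsum := sum_mul_eq_of_leak_inertia ε K C (fun t => Tstar t - T t) F (by simp [h4]) (τ - 1)
    fun t ht => by
      have ht' := h1 t (Finset.Icc_subset_Icc_right (Nat.sub_le τ 1) ht)
      linarith [h2 t ht]
  have hτ1 := h1 τ (Finset.mem_Icc.2 ⟨by omega, le_rfl⟩)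
  have heq : Zτ - (∑ t ∈ Finset.Icc 1 (τ - 1), F t)
      = -(K / ε) * ∑ t ∈ Finset.Icc 1 (τ - 1), (Tstar t - T t) := by
    field_simp
    linarith
  refine ⟨heq, fun hlt => ?_⟩
  have hpos : 0 < ∑ t ∈ Finset.Icc 1 (τ - 1), (Tstar t - T t) :=
    Finset.sum_pos (fun t ht => sub_pos.2 (hlt t ht)) (Finset.nonempty_Icc.2 (by omega))
  rw [heq, neg_mul]
  exact neg_neg_of_pos (mul_pos (div_pos hK hε) hpos)
end

section
/- Fix an integer τ ≥ 2 and real constants ε > 0, ε'(τ) (coefficients of performance), K (leakiness), C (thermal inertia). Let θ, T*, T, D^a be real sequences and define Z(τ−1) = Σ_{t=1}^{τ−1} D^a(t), and let Z(τ) be a real number. Assume: (i) D^a(t)·ε = K(T*(t) − θ(t)) + C(T*(t) − T*(t−1)) for t = 1,…,τ; (ii) 0 = K(T(t) − θ(t)) + C(T(t) − T(t−1)) for t = 1,…,τ−1; (iii) (D^a(τ) + Z(τ))·ε'(τ) = K(T*(τ) − θ(τ)) + C(T*(τ) − T(τ−1)); (iv) T(0) = T*(0). Then Z(τ) − Z(τ−1)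 = −(K/ε)·Σ_{t=1}^{τ−1}(T*(t) − T(t)) + (1 − ε'(τ)/ε)·(D^a(τ) + Z(τ)). -/
/-- Total heat supplied in a heated scenario, compared with an unheated one started at the same
temperature: the differences in the inertia terms telescope. -/
theorem sum_mul_eq_of_heat_balance {n : ℕ} {ε K C : ℝ} {θ S T D : ℕ → ℝ}
    (hS : ∀ t ∈ Finset.Icc 1 n, D t * ε = K * (S t - θ t) + C * (S t - S (t - 1)))
    (hT : ∀ t ∈ Finset.Icc 1 n, (0 : ℝ) = K * (T t - θ t) + C * (T t - T (t - 1)))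
    (h0 : T 0 = S 0) :
    (∑ t ∈ Finset.Icc 1 n, D t) * ε
      = K * (∑ t ∈ Finset.Icc 1 n, (S t - T t)) + C * (S n - T n) := by
  induction n with
  | zero => simp [h0]
  | succ n ih =>
    have hsub := Finset.Icc_subset_Icc_right (a := 1) n.le_succ
    have ih := ih (fun t ht => hS t (hsub ht)) (fun t ht => hT t (hsub ht))
    have hSn := hS (n + 1) (by simp)
    have hTn := hT (n + 1) (by simp)
    simp only [Nat.add_sub_cancel] at hSn hTn
    rw [Finset.sum_Icc_succ_top (by omega), Finset.sum_Icc_succ_top (by omega)]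
    linear_combination ih + hSn - hTn

/-- Appendix A.2, heat pumps with reduced coefficient of performance.
Under the two-scenario heating model where all demand is frustrated at times `1,…,τ−1`
and the energy `D^a(τ) + Z(τ)` is used at time `τ` with coefficient of performance `ε'(τ)`,
the backlogged demand satisfies
`Z(τ) − Z(τ−1) = −(K/ε)·Σ_{t=1}^{τ−1}(T*(t) − T(t)) + (1 − ε'(τ)/ε)·(D^a(τ) + Z(τ))`,
where `Z(τ−1) = Σ_{t=1}^{τ−1} D^a(t)`. -/
theorem heat_pump_evaporation
    (τ : ℕ) (hτ : 2 ≤ τ) (ε ε' K C : ℝ) (hε : 0 < ε)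
    (θ Tstar T Da : ℕ → ℝ) (Zτ : ℝ)
    (h1 : ∀ t ∈ Finset.Icc 1 τ,
      Da t * ε = K * (Tstar t - θ t) + C * (Tstar t - Tstar (t - 1)))
    (h2 : ∀ t ∈ Finset.Icc 1 (τ - 1),
      (0 : ℝ) = K * (T t - θ t) + C * (T t - T (t - 1)))
    (h3 : (Da τ + Zτ) * ε' = K * (Tstar τ - θ τ) + C * (Tstar τ - T (τ - 1)))
    (h4 : T 0 = Tstar 0) :
    Zτ - (∑ t ∈ Finset.Icc 1 (τ - 1), Da t)
      = -(K / ε) * (∑ t ∈ Finset.Icc 1 (τ - 1), (Tstar t - T t))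
        + (1 - ε' / ε) * (Da τ + Zτ) := by
  obtain ⟨n, rfl⟩ : ∃ n, τ = n + 1 := ⟨τ - 1, by omega⟩
  simp only [Nat.add_sub_cancel] at h2 h3 ⊢
  have hS := sum_mul_eq_of_heat_balance
    (fun t ht => h1 t (Finset.Icc_subset_Icc_right n.le_succ ht)) h2 h4
  have hlast := h1 (n + 1) (by simp)
  simp only [Nat.add_sub_cancel] at hlast
  field_simp
  linear_combination h3 - hlast - hS
end
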